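/- Let n ≥ 1, m ≥ 1, let a₁,…,a_m be constants with each aᵢ > 1, set a = Σᵢ₌₁ᵐ aᵢ, and let α = (n+2a+2)/(n+2a-2). Suppose u : ℝⁿ × [0,∞)ᵐ → ℝ is nonnegative, of class C² up to the boundary, and satisfies Σᵢ₌₁ᵐ yᵢ·∂²u/∂yᵢ² + Σᵢ₌₁ᵐ aᵢ·∂u/∂yᵢ + Δₓu + u^α = 0 at every point with all yᵢ > 0. Then there exist x₀ ∈ ℝⁿ and t ≥ 0 such that u(x,y) = ( t·√((n+2a)(n+2a−2)) / (t² + 4·Σᵢ₌₁ᵐ yᵢ + |x−x₀|²) )^{(n+2a−2)/2} for all (x,y). -/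

import Mathlib

/-- Second partial derivative in the `i`-th `x`-variable. -/
noncomputable def pdxx (n m : ℕ) (u : (Fin n → ℝ) × (Fin m → ℝ) → ℝ) (i : Fin n)
    (x : Fin n → ℝ) (y : Fin m → ℝ) : ℝ :=
  deriv (fun t => deriv (fun s => u (Function.update x i s, y)) t) (x i)

/-- First partial derivative in the `i`-th `y`-variable. -/
noncomputable def pdy (n m : ℕ) (u : (Fin n → ℝ) × (Fin m → ℝ) → ℝ) (i : Fin m)
    (x : Fin n → ℝ) (y : Fin m → ℝ) : ℝ :=
  deriv (fun t => u (x, Function.update y i t)) (y i)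

/-- Second partial derivative in the `i`-th `y`-variable. -/
noncomputable def pdyy (n m : ℕ) (u : (Fin n → ℝ) × (Fin m → ℝ) → ℝ) (i : Fin m)
    (x : Fin n → ℝ) (y : Fin m → ℝ) : ℝ :=
  deriv (fun t => deriv (fun s => u (x, Function.update y i s)) t) (y i)


namespace LC
open Filter Topology

/-- Basis vector. -/
noncomputable def ee {ι : Type*} [DecidableEq ι] [Fintype ι] (j : ι) : EuclideanSpace ℝ ι :=
  EuclideanSpace.single j (1 : ℝ)

/-- The operator. -/
noncomputable def Lop {ι : Type*} [DecidableEq ι] [Fintype ι] (b : ι → ℝ)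
    (f : EuclideanSpace ℝ ι → ℝ) (z : EuclideanSpace ℝ ι) : ℝ :=
  ∑ j, (fderiv ℝ (fderiv ℝ f) z (ee j) (ee j) + b j / z j * fderiv ℝ f z (ee j))

/-- The regular set. -/
def QQ {ι : Type*} (b : ι → ℝ) : Set (EuclideanSpace ℝ ι) := {z | ∀ j, b j ≠ 0 → z j ≠ 0}

/-- The plane of admissible centers. -/
def PP {ι : Type*} (b : ι → ℝ) : Set (EuclideanSpace ℝ ι) := {z | ∀ j, b j ≠ 0 → z j = 0}

section gen
variable {E : Type*} [NormedAddCommGroup E] [NormedSpace ℝ E]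

lemma line_hasDeriv (z e : E) (t : ℝ) : HasDerivAt (fun t : ℝ => z + t • e) e t := by
  simpa using ((hasDerivAt_id t).smul_const e).const_add z

lemma line_eventually {f : E → ℝ} {z : E} (e : E) (h : ContDiffAt ℝ 2 f z) :
    ∀ᶠ t : ℝ in 𝓝 0, HasDerivAt (fun t : ℝ => f (z + t • e)) (fderiv ℝ f (z + t • e) e) t := by
  have h1 : ∀ᶠ y in 𝓝 z, ContDiffAt ℝ 2 f y := h.eventually (by simp)
  have hc : Tendsto (fun t : ℝ => z + t • e) (𝓝 0) (𝓝 z) := by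
    have : Continuous (fun t : ℝ => z + t • e) := by fun_prop
    simpa using this.tendsto 0
  filter_upwards [hc.eventually h1] with t ht
  exact ((ht.differentiableAt (by norm_num)).hasFDerivAt).comp_hasDerivAt t (line_hasDeriv z e t)

lemma fd_diff {f : E → ℝ} {z : E} (h : ContDiffAt ℝ 2 f z) :
    DifferentiableAt ℝ (fderiv ℝ f) z :=
  (h.fderiv_right (m := 1) (by norm_num)).differentiableAt (by norm_num)

lemma line_second {f : E → ℝ} {z : E} (e : E) (h : ContDiffAt ℝ 2 f z) :
    HasDerivAt (fun t : ℝ => fderiv ℝ f (z + t • e) e) (fderiv ℝ (fderiv ℝ f) z e e) 0 := by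
  have h1 : HasFDerivAt (fderiv ℝ f) (fderiv ℝ (fderiv ℝ f) z) (z + (0:ℝ) • e) := by
    simpa using (fd_diff h).hasFDerivAt
  have h2 := h1.comp_hasDerivAt (0:ℝ) (line_hasDeriv z e 0)
  simpa using h2.clm_apply (hasDerivAt_const (0:ℝ) e)

lemma line_lemma {f : E → ℝ} {z e : E} (h : ContDiffAt ℝ 2 f z) {g : ℝ → ℝ} {s : ℝ}
    (hg : ∀ᶠ t : ℝ in 𝓝 0, HasDerivAt (fun t : ℝ => f (z + t • e)) (g t) t)
    (hs : HasDerivAt g s 0) :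
    fderiv ℝ f z e = g 0 ∧ fderiv ℝ (fderiv ℝ f) z e e = s := by
  have h1 : g =ᶠ[𝓝 0] fun t : ℝ => fderiv ℝ f (z + t • e) e := by
    filter_upwards [hg, line_eventually e h] with t h1 h2
    exact h1.unique h2
  refine ⟨?_, ?_⟩
  · simpa using h1.self_of_nhds.symm
  · exact ((line_second e h).congr_of_eventuallyEq h1).unique hs

lemma second_test {φ g : ℝ → ℝ} {s : ℝ} (h0 : ∀ᶠ t in 𝓝 (0:ℝ), φ 0 ≤ φ t)
    (h1 : ∀ᶠ t in 𝓝 (0:ℝ), HasDerivAt φ (g t) t) (h2 : HasDerivAt g s 0) :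
    g 0 = 0 ∧ 0 ≤ s := by
  have hmin : IsLocalMin φ 0 := h0
  have hg0 : g 0 = 0 := hmin.hasDerivAt_eq_zero h1.self_of_nhds
  refine ⟨hg0, ?_⟩
  by_contra hs
  push Not at hs
  have hd : deriv φ =ᶠ[𝓝 0] g := h1.mono (fun t ht => ht.deriv)
  have hdd : deriv (deriv φ) 0 = s := by rw [hd.deriv_eq]; exact h2.deriv
  have hmax : IsLocalMax φ 0 := by
    apply isLocalMax_of_deriv_deriv_neg
    · rw [hdd]; exact hs
    · rw [h1.self_of_nhds.deriv, hg0]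
    · exact h1.self_of_nhds.continuousAt
  have hconst : φ =ᶠ[𝓝 0] fun _ => φ 0 := by
    filter_upwards [hmin, hmax] with t a b
    exact le_antisymm b a
  have h3 : deriv φ =ᶠ[𝓝 0] deriv (fun _ => φ 0) := hconst.deriv
  have h4 := h3.deriv_eq
  simp at h4
  linarith

lemma quad_test {f : E → ℝ} {z e : E} (h : ContDiffAt ℝ 2 f z) {c1 c2 : ℝ}
    (h0 : ∀ᶠ t : ℝ in 𝓝 0, f z + c1 * t + c2 * t ^ 2 ≤ f (z + t • e)) :
    fderiv ℝ f z e = c1 ∧ 2 * c2 ≤ fderiv ℝ (fderiv ℝ f) z e e := by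
  have := second_test (φ := fun t => f (z + t • e) - c1 * t - c2 * t ^ 2)
    (g := fun t => fderiv ℝ f (z + t • e) e - c1 - c2 * (2 * t))
    (s := fderiv ℝ (fderiv ℝ f) z e e - c2 * 2) ?_ ?_ ?_
  · obtain ⟨h1, h2⟩ := this
    simp at h1
    constructor <;> linarith
  · filter_upwards [h0] with t ht
    simp
    linarith
  · filter_upwards [line_eventually e h] with t ht
    have h1 := (ht.sub ((hasDerivAt_id t).const_mul c1)).sub ((hasDerivAt_pow 2 t).const_mul c2)
    exact h1.congr_deriv (by simp)
  · have h1 := ((line_second e h).sub_const c1).sub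
      (((hasDerivAt_id (0:ℝ)).const_mul 2).const_mul c2)
    exact h1.congr_deriv (by simp)

end gen

variable {ι : Type*} [DecidableEq ι] [Fintype ι]

lemma ee_apply (j k : ι) : (ee j : EuclideanSpace ℝ ι) k = if k = j then 1 else 0 := by
  simp [ee]

lemma normsq (z : EuclideanSpace ℝ ι) : ‖z‖ ^ 2 = ∑ j, z j ^ 2 := by
  rw [EuclideanSpace.real_norm_sq_eq]

lemma sum_ee (z : EuclideanSpace ℝ ι) : ∑ j, z j • (ee j : EuclideanSpace ℝ ι) = z := by
  ext k
  simp [ee_apply]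

lemma normsq_line (z : EuclideanSpace ℝ ι) (j : ι) (t : ℝ) :
    ‖z + t • ee j‖ ^ 2 = ‖z‖ ^ 2 + 2 * z j * t + t ^ 2 := by
  rw [@norm_add_sq_real]
  simp [ee, norm_smul, inner_smul_right, EuclideanSpace.inner_single_right]
  ring

lemma MP [Nonempty ι] {b : ι → ℝ} (hb : ∀ j, 0 ≤ b j) {K O : Set (EuclideanSpace ℝ ι)}
    (hK : IsCompact K) (hO : IsOpen O) (hOK : O ⊆ K) {w : EuclideanSpace ℝ ι → ℝ}
    (hc : ContinuousOn w K) (hbd : ∀ z ∈ K, z ∉ O → 0 ≤ w z)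
    (hd : ∀ z ∈ O, DifferentiableAt ℝ w z)
    (h2 : ∀ z ∈ O, z ∈ QQ b → ContDiffAt ℝ 2 w z)
    (hL : ∀ z ∈ O, z ∈ QQ b → w z < 0 → Lop b w z ≤ 0) : ∀ z ∈ K, 0 ≤ w z := by
  intro z0 hz0
  by_contra hneg
  push Not at hneg
  set ψ : EuclideanSpace ℝ ι → ℝ := fun z => ‖z‖ ^ 2 + ∑ j, b j * |z j| with hψ
  have hψc : Continuous ψ := by fun_prop
  have hψ0 : ∀ z, 0 ≤ ψ z := fun z => by
    have := Finset.sum_nonneg (s := Finset.univ) (fun j _ => mul_nonneg (hb j) (abs_nonneg (z j)))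
    simp only [hψ]
    positivity
  obtain ⟨M, hM⟩ := (hK.image hψc).bddAbove
  have hM' : ∀ z ∈ K, ψ z ≤ M := fun z hz => hM ⟨z, hz, rfl⟩
  have hM0 : 0 ≤ M := (hψ0 z0).trans (hM' z0 hz0)
  obtain ⟨ε, hε, hεM⟩ : ∃ ε > 0, ε * M < - w z0 := by
    refine ⟨- w z0 / (2 * (M + 1)), by apply div_pos <;> linarith, ?_⟩
    rw [div_mul_eq_mul_div, div_lt_iff₀ (by linarith)]
    nlinarith
  have hcε : ContinuousOn (fun z => w z - ε * ψ z) K :=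
    hc.sub (continuous_const.mul hψc).continuousOn
  obtain ⟨z1, hz1, hmin⟩ := hK.exists_isMinOn ⟨z0, hz0⟩ hcε
  have hmin' : ∀ z ∈ K, w z1 - ε * ψ z1 ≤ w z - ε * ψ z := fun z hz => hmin hz
  have hw1 : w z1 < 0 := by
    have h1 := hmin' z0 hz0
    have h2 := mul_le_mul_of_nonneg_left (hM' z1 hz1) hε.le
    have h3 := mul_nonneg hε.le (hψ0 z0)
    linarith
  have hz1O : z1 ∈ O := by
    by_contra h
    exact absurd (hbd z1 hz1 h) (not_le.2 hw1)
  have hnear : ∀ j : ι, ∀ᶠ t : ℝ in 𝓝 0, z1 + t • ee j ∈ O := by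
    intro j
    have hc : Continuous (fun t : ℝ => z1 + t • (ee j : EuclideanSpace ℝ ι)) := by fun_prop
    exact hc.continuousAt.eventually_mem (by simpa using hO.mem_nhds hz1O)
  have hψl : ∀ (j : ι) (t : ℝ), ψ (z1 + t • ee j) - ψ z1
      = 2 * z1 j * t + t ^ 2 + b j * (|z1 j + t| - |z1 j|) := by
    intro j t
    simp only [hψ]
    rw [normsq_line]
    have : ∑ k, b k * |(z1 + t • ee j) k| - ∑ k, b k * |z1 k| = b j * (|z1 j + t| - |z1 j|) := by
      rw [← Finset.sum_sub_distrib, Finset.sum_eq_single j]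
      · simp [ee_apply]; ring
      · intro k _ hk
        simp [ee_apply, hk]
      · simp
    linarith
  by_cases hQ : z1 ∈ QQ b
  · have hcd := h2 z1 hz1O hQ
    have key : ∀ j, fderiv ℝ w z1 (ee j) = ε * (2 * z1 j + b j * SignType.sign (z1 j)) ∧
        2 * ε ≤ fderiv ℝ (fderiv ℝ w) z1 (ee j) (ee j) := by
      intro j
      apply quad_test hcd
      filter_upwards [hnear j] with t ht
      have h1 := hmin' _ (hOK ht)
      have h3 := hψl j t
      have h4 : (SignType.sign (z1 j) : ℝ) * t ≤ |z1 j + t| - |z1 j| := by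
        rcases lt_trichotomy (z1 j) 0 with h | h | h
        · rw [sign_neg h, abs_of_neg h]
          have := neg_abs_le (z1 j + t)
          simp; linarith
        · simp [h]
        · rw [sign_pos h, abs_of_pos h]
          have := le_abs_self (z1 j + t)
          simp; linarith
      have h5 := mul_le_mul_of_nonneg_left h4 (hb j)
      have h6 := mul_le_mul_of_nonneg_left h5 hε.le
      have h7 : ε * (ψ (z1 + t • ee j) - ψ z1) = ε * (2 * z1 j * t + t ^ 2 + b j * (|z1 j + t| - |z1 j|)) := by rw [h3]
      linarith
    have hpos : 0 < Lop b w z1 := by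
      unfold Lop
      apply Finset.sum_pos _ Finset.univ_nonempty
      intro j _
      obtain ⟨h1, h3⟩ := key j
      rw [h1]
      have : 0 ≤ b j / z1 j * (ε * (2 * z1 j + b j * SignType.sign (z1 j))) := by
        rcases lt_trichotomy (z1 j) 0 with h | h | h
        · rw [sign_neg h]
          apply mul_nonneg_of_nonpos_of_nonpos
          · exact div_nonpos_of_nonneg_of_nonpos (hb j) h.le
          · apply mul_nonpos_of_nonneg_of_nonpos hε.le
            have := hb j
            simp; linarith
        · simp [h]
        · rw [sign_pos h]
          have := hb j
          simp
          positivity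
      linarith
    exact absurd (hL z1 hz1O hQ hw1) (not_le.2 hpos)
  · simp only [QQ, Set.mem_ofPred_eq, not_forall, not_not] at hQ
    obtain ⟨j, hbj, hzj⟩ := hQ
    have hbp : 0 < b j := lt_of_le_of_ne (hb j) (Ne.symm hbj)
    have hder : HasDerivAt (fun t : ℝ => w (z1 + t • ee j)) (fderiv ℝ w z1 (ee j)) 0 := by
      have h1 : HasFDerivAt w (fderiv ℝ w z1) (z1 + (0:ℝ) • ee j) := by
        simpa using (hd z1 hz1O).hasFDerivAt
      exact h1.comp_hasDerivAt (0:ℝ) (line_hasDeriv z1 (ee j) 0)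
    have hge : ∀ᶠ t : ℝ in 𝓝 0, w z1 + ε * b j * |t| ≤ w (z1 + t • ee j) := by
      filter_upwards [hnear j] with t ht
      have h1 := hmin' _ (hOK ht)
      have h3 := hψl j t
      rw [hzj] at h3
      simp at h3
      have h7 : ε * (ψ (z1 + t • ee j) - ψ z1) = ε * (t ^ 2 + b j * |t|) := by rw [h3]
      have : 0 ≤ ε * t ^ 2 := by positivity
      linarith
    have m1 : IsLocalMin (fun t => w (z1 + t • ee j) - ε * b j * t) 0 := by
      filter_upwards [hge] with t ht
      have := mul_le_mul_of_nonneg_left (le_abs_self t) (mul_pos hε hbp).le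
      simp
      linarith
    have m2 : IsLocalMin (fun t => w (z1 + t • ee j) + ε * b j * t) 0 := by
      filter_upwards [hge] with t ht
      have := mul_le_mul_of_nonneg_left (neg_abs_le t) (mul_pos hε hbp).le
      simp
      linarith
    have e1 := m1.hasDerivAt_eq_zero (hder.sub ((hasDerivAt_id (0:ℝ)).const_mul (ε * b j)))
    have e2 := m2.hasDerivAt_eq_zero (hder.add ((hasDerivAt_id (0:ℝ)).const_mul (ε * b j)))
    have := mul_pos hε hbp
    linarith

end LC


namespace LC
open Filter Topology
variable {ι : Type*} [DecidableEq ι] [Fintype ι]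

lemma Lop_lin {b : ι → ℝ} {f g : EuclideanSpace ℝ ι → ℝ} {z : EuclideanSpace ℝ ι}
    (hf : ContDiffAt ℝ 2 f z) (hg : ContDiffAt ℝ 2 g z) (c1 c2 c3 : ℝ) :
    Lop b (fun z => c1 * f z + c2 * g z + c3) z = c1 * Lop b f z + c2 * Lop b g z := by
  have h : ContDiffAt ℝ 2 (fun z => c1 * f z + c2 * g z + c3) z :=
    ((contDiffAt_const.mul hf).add (contDiffAt_const.mul hg)).add contDiffAt_const
  unfold Lop
  rw [Finset.mul_sum, Finset.mul_sum, ← Finset.sum_add_distrib]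
  apply Finset.sum_congr rfl
  intro j _
  obtain ⟨h1, h2⟩ := line_lemma (e := ee j) h
    (g := fun t => c1 * fderiv ℝ f (z + t • ee j) (ee j) + c2 * fderiv ℝ g (z + t • ee j) (ee j))
    (by
      filter_upwards [line_eventually (ee j) hf, line_eventually (ee j) hg] with t h1 h2
      exact ((h1.const_mul c1).add (h2.const_mul c2)).add_const c3)
    (((line_second (ee j) hf).const_mul c1).add ((line_second (ee j) hg).const_mul c2))
  rw [h1, h2]
  simp
  ring

lemma ne_normsq {z : EuclideanSpace ℝ ι} (hz : z ≠ 0) : 0 < ‖z‖ ^ 2 := by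
  have := norm_pos_iff.2 hz
  positivity

lemma radial_smooth {x z : EuclideanSpace ℝ ι} (hz : z ≠ x) (s : ℝ) :
    ContDiffAt ℝ 2 (fun z => (‖z - x‖ ^ 2) ^ s) z := by
  have h1 : ContDiffAt ℝ 2 (fun z => ‖z - x‖ ^ 2) z :=
    ((contDiffAt_id.sub contDiffAt_const).norm_sq ℝ)
  exact h1.rpow_const_of_ne (ne_normsq (sub_ne_zero.2 hz)).ne'

lemma rad_line {ρ c s : ℝ} (hρ : 0 < ρ) :
    (∀ᶠ t : ℝ in 𝓝 0, 0 < ρ + 2 * c * t + t ^ 2 ∧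
      HasDerivAt (fun t : ℝ => (ρ + 2 * c * t + t ^ 2) ^ s)
        (s * (ρ + 2 * c * t + t ^ 2) ^ (s - 1) * (2 * c + 2 * t)) t) ∧
    HasDerivAt (fun t : ℝ => s * (ρ + 2 * c * t + t ^ 2) ^ (s - 1) * (2 * c + 2 * t))
      (s * ((s - 1) * ρ ^ (s - 2) * (2 * c) ^ 2 + 2 * ρ ^ (s - 1))) 0 := by
  have hder : ∀ t : ℝ, HasDerivAt (fun t : ℝ => ρ + 2 * c * t + t ^ 2) (2 * c + 2 * t) t := by
    intro t
    have := (((hasDerivAt_id t).const_mul (2 * c)).const_add ρ).add (hasDerivAt_pow 2 t)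
    exact this.congr_deriv (by simp)
  have hev : ∀ᶠ t : ℝ in 𝓝 0, 0 < ρ + 2 * c * t + t ^ 2 := by
    have hc : Continuous (fun t : ℝ => ρ + 2 * c * t + t ^ 2) := by fun_prop
    exact (hc.tendsto' 0 ρ (by simp)).eventually_const_lt hρ
  constructor
  · filter_upwards [hev] with t ht
    refine ⟨ht, ?_⟩
    exact ((hder t).rpow_const (p := s) (Or.inl ht.ne')).congr_deriv (by ring)
  · have h1 := (hder 0).rpow_const (p := s - 1) (Or.inl (by simpa using hρ.ne'))
    have h2 : HasDerivAt (fun t : ℝ => 2 * c + 2 * t) 2 0 := by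
      simpa using ((hasDerivAt_id (0:ℝ)).const_mul 2).const_add (2 * c)
    refine ((h1.const_mul s).mul h2).congr_deriv ?_
    have : s - 1 - 1 = s - 2 := by ring
    simp [this]
    ring

lemma radial_Lop {b : ι → ℝ} {x z : EuclideanSpace ℝ ι} (hz : z ≠ x) (hx : x ∈ PP b)
    (hQ : z ∈ QQ b) (s : ℝ) :
    Lop b (fun z => (‖z - x‖ ^ 2) ^ s) z =
      s * (‖z - x‖ ^ 2) ^ (s - 1) * (4 * (s - 1) + 2 * (Fintype.card ι + ∑ j, b j)) := by
  have hρ := ne_normsq (sub_ne_zero.2 hz)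
  set ρ := ‖z - x‖ ^ 2 with hρd
  have hterm : ∀ j, fderiv ℝ (fderiv ℝ (fun z => (‖z - x‖ ^ 2) ^ s)) z (ee j) (ee j)
      + b j / z j * fderiv ℝ (fun z => (‖z - x‖ ^ 2) ^ s) z (ee j) =
      4 * s * (s - 1) * ρ ^ (s - 2) * ((z - x) j) ^ 2 + 2 * s * ρ ^ (s - 1)
        + 2 * s * ρ ^ (s - 1) * b j := by
    intro j
    obtain ⟨ha, hb⟩ := rad_line (ρ := ρ) (c := (z - x) j) (s := s) hρ
    have hfun : (fun t : ℝ => (‖z + t • ee j - x‖ ^ 2) ^ s) =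
        fun t : ℝ => (ρ + 2 * (z - x) j * t + t ^ 2) ^ s := by
      ext t
      rw [hρd, ← normsq_line]
      congr 3
      abel
    obtain ⟨h1, h2⟩ := line_lemma (e := ee j) (radial_smooth hz s)
      (by rw [hfun]; exact ha.mono fun t ht => ht.2) hb
    rw [h1, h2]
    have : b j / z j * (z - x) j = b j := by
      by_cases hbj : b j = 0
      · simp [hbj]
      · simp only [PiLp.sub_apply, hx j hbj, sub_zero]
        exact div_mul_cancel₀ _ (hQ j hbj)
    simp only [mul_zero, add_zero]
    have e0 : (0:ℝ)^2 = 0 := by norm_num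
    rw [e0, add_zero]
    calc _ = s * ((s - 1) * ρ ^ (s - 2) * (2 * (z - x) j) ^ 2 + 2 * ρ ^ (s - 1)) +
          2 * s * ρ ^ (s - 1) * (b j / z j * (z - x) j) := by ring
      _ = _ := by rw [this]; ring
  unfold Lop
  rw [Finset.sum_congr rfl (fun j _ => hterm j), Finset.sum_add_distrib, Finset.sum_add_distrib,
    ← Finset.mul_sum, ← Finset.mul_sum, ← normsq, ← hρd]
  simp only [Finset.sum_const, Finset.card_univ, nsmul_eq_mul]
  have : ρ ^ (s - 2) * ρ = ρ ^ (s - 1) := by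
    rw [← Real.rpow_add_one hρ.ne']; congr 1; ring
  calc _ = 4 * s * (s - 1) * (ρ ^ (s - 2) * ρ) + Fintype.card ι * (2 * s * ρ ^ (s - 1)) +
        2 * s * ρ ^ (s - 1) * ∑ j, b j := by simp only [Finset.mul_sum]; ring
    _ = _ := by rw [this]; ring

/-- Kelvin transform. -/
noncomputable def Kel (σ l : ℝ) (F : EuclideanSpace ℝ ι → ℝ) (z : EuclideanSpace ℝ ι) : ℝ :=
  (‖z‖ ^ 2) ^ (-σ) * (l ^ (2 * σ) * F ((l ^ 2 / ‖z‖ ^ 2) • z))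

lemma inv_smooth {z : EuclideanSpace ℝ ι} (hz : z ≠ 0) (l : ℝ) :
    ContDiffAt ℝ 2 (fun z : EuclideanSpace ℝ ι => (l ^ 2 / ‖z‖ ^ 2) • z) z := by
  have h1 : ContDiffAt ℝ 2 (fun z : EuclideanSpace ℝ ι => ‖z‖ ^ 2) z := contDiffAt_id.norm_sq ℝ
  exact (contDiffAt_const.div h1 (ne_normsq hz).ne').smul contDiffAt_id

lemma Kel_smooth {σ l : ℝ} {F : EuclideanSpace ℝ ι → ℝ} {z : EuclideanSpace ℝ ι} (hz : z ≠ 0)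
    (hF : ContDiffAt ℝ 2 F ((l ^ 2 / ‖z‖ ^ 2) • z)) : ContDiffAt ℝ 2 (Kel σ l F) z := by
  have h1 : ContDiffAt ℝ 2 (fun z : EuclideanSpace ℝ ι => ‖z‖ ^ 2) z := contDiffAt_id.norm_sq ℝ
  exact (h1.rpow_const_of_ne (ne_normsq hz).ne').mul
    (contDiffAt_const.mul (ContDiffAt.comp (f := fun z : EuclideanSpace ℝ ι => (l ^ 2 / ‖z‖ ^ 2) • z) z hF
      (inv_smooth hz l)))

lemma Kel_diff {σ l : ℝ} {F : EuclideanSpace ℝ ι → ℝ} {z : EuclideanSpace ℝ ι} (hz : z ≠ 0)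
    (hF : Differentiable ℝ F) : DifferentiableAt ℝ (Kel σ l F) z := by
  have h1 : ContDiffAt ℝ 2 (fun z : EuclideanSpace ℝ ι => ‖z‖ ^ 2) z := contDiffAt_id.norm_sq ℝ
  exact ((h1.rpow_const_of_ne (ne_normsq hz).ne').differentiableAt (by norm_num)).mul
    (((hF _).comp z ((inv_smooth hz l).differentiableAt (by norm_num))).const_mul _)

lemma Kel_term {σ l : ℝ} (b : ι → ℝ) {F : EuclideanSpace ℝ ι → ℝ} {z : EuclideanSpace ℝ ι}
    (hz : z ≠ 0) (hF : ContDiffAt ℝ 2 F ((l ^ 2 / ‖z‖ ^ 2) • z)) (j : ι) (hQ : b j ≠ 0 → z j ≠ 0)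
    (ρ μ c X Fz : ℝ) (A : EuclideanSpace ℝ ι →L[ℝ] ℝ)
    (H : EuclideanSpace ℝ ι →L[ℝ] EuclideanSpace ℝ ι →L[ℝ] ℝ)
    (hρ : ρ = ‖z‖ ^ 2) (hμ : μ = l ^ 2) (hc : c = l ^ (2 * σ)) (hX : X = ρ ^ (-σ))
    (hFz : Fz = F ((l ^ 2 / ‖z‖ ^ 2) • z)) (hA : A = fderiv ℝ F ((l ^ 2 / ‖z‖ ^ 2) • z))
    (hH : H = fderiv ℝ (fderiv ℝ F) ((l ^ 2 / ‖z‖ ^ 2) • z)) :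
    fderiv ℝ (fderiv ℝ (Kel σ l F)) z (ee j) (ee j) + b j / z j * fderiv ℝ (Kel σ l F) z (ee j)
     = (4 * σ * (σ + 1) * X / ρ ^ 2 * c * Fz + 8 * σ * c * μ * X / ρ ^ 3 * A z
          + 8 * c * X * μ / ρ ^ 3 * A z + 4 * c * X * μ ^ 2 / ρ ^ 4 * H z z) * z j ^ 2
        + (- 2 * σ * X / ρ * c * Fz - 2 * c * X * μ / ρ ^ 2 * A z)
        + (-4 * σ * c * μ * X / ρ ^ 2 - 4 * c * X * μ / ρ ^ 2) * (z j * A (ee j))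
        + c * X * μ ^ 2 / ρ ^ 2 * H (ee j) (ee j)
        + (- 2 * c * X * μ ^ 2 / ρ ^ 3) * (z j * H (ee j) z)
        + (- 2 * c * X * μ ^ 2 / ρ ^ 3) * (z j * H z (ee j))
        + (- 2 * σ * X / ρ * c * Fz - 2 * c * X * μ / ρ ^ 2 * A z) * b j
        + c * X * μ / ρ * (b j / z j * A (ee j)) := by
  have hρ0 : 0 < ρ := hρ ▸ ne_normsq hz
  obtain ⟨ha, hb⟩ := rad_line (ρ := ρ) (c := z j) (s := -σ) hρ0
  have hder : ∀ t : ℝ, HasDerivAt (fun t : ℝ => ρ + 2 * z j * t + t ^ 2) (2 * z j + 2 * t) t := by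
    intro t
    have := (((hasDerivAt_id t).const_mul (2 * z j)).const_add ρ).add (hasDerivAt_pow 2 t)
    exact this.congr_deriv (by simp)
  set r : ℝ → ℝ := fun t => ρ + 2 * z j * t + t ^ 2 with hr
  have hr0 : r 0 = ρ := by simp [hr]
  set Φ : ℝ → EuclideanSpace ℝ ι := fun t => (μ / r t) • (z + t • ee j) with hΦ
  set Φ' : ℝ → EuclideanSpace ℝ ι :=
    fun t => (μ / r t) • ee j + (-(μ * (2 * z j + 2 * t)) / r t ^ 2) • (z + t • ee j) with hΦ'
  have hΦd : ∀ t, 0 < r t → HasDerivAt Φ (Φ' t) t := by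
    intro t ht
    have h1 : HasDerivAt (fun t => μ / r t) (-(μ * (2 * z j + 2 * t)) / r t ^ 2) t :=
      ((hasDerivAt_const t μ).div (hder t) ht.ne').congr_deriv (by simp)
    exact h1.smul (line_hasDeriv z (ee j) t)
  have hΦ'd : HasDerivAt Φ' ((2 * (-(2 * μ * z j) / ρ ^ 2)) • ee j +
      (μ * (-2 / ρ ^ 2 + 8 * z j ^ 2 / ρ ^ 3)) • z) 0 := by
    have h1 : HasDerivAt (fun t => μ / r t) (-(μ * (2 * z j + 2 * 0)) / r 0 ^ 2) 0 :=
      ((hasDerivAt_const 0 μ).div (hder 0) (by rw [hr0]; exact hρ0.ne')).congr_deriv (by simp)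
    have h2 : HasDerivAt (fun t : ℝ => -(μ * (2 * z j + 2 * t))) (-(μ * 2)) 0 := by
      exact ((((hasDerivAt_id (0:ℝ)).const_mul 2).const_add (2 * z j)).const_mul μ).neg.congr_deriv
        (by simp)
    have h3 : HasDerivAt (fun t => r t ^ 2) (2 * ρ * (2 * z j)) 0 := by
      have := (hder 0).pow 2
      exact this.congr_deriv (by simp [hr0])
    have h4 : HasDerivAt (fun t : ℝ => -(μ * (2 * z j + 2 * t)) / r t ^ 2)
        (μ * (-2 / ρ ^ 2 + 8 * z j ^ 2 / ρ ^ 3)) 0 := by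
      refine (h2.div h3 (by rw [hr0]; positivity)).congr_deriv ?_
      rw [hr0]
      field_simp
      ring
    refine ((h1.smul_const (ee j)).add (h4.smul (line_hasDeriv z (ee j) 0))).congr_deriv ?_
    rw [hr0]
    simp only [mul_zero, add_zero, zero_smul]
    rw [← add_assoc, ← add_smul]
    congr 2
    ring
  have hΦ0 : Φ 0 = (l ^ 2 / ‖z‖ ^ 2) • z := by simp [hΦ, hr0, hμ, hρ]
  have hΦ'0 : Φ' 0 = (μ / ρ) • ee j + (-(2 * μ * z j) / ρ ^ 2) • z := by
    simp only [hΦ', hr0]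
    simp only [mul_zero, add_zero, zero_smul]
    congr 3
    ring
  have hFev : ∀ᶠ t : ℝ in 𝓝 0, DifferentiableAt ℝ F (Φ t) := by
    have h1 : ∀ᶠ y in 𝓝 (Φ 0), ContDiffAt ℝ 2 F y := by
      rw [hΦ0]; exact hF.eventually (by simp)
    have h2 : ContinuousAt Φ 0 := (hΦd 0 (by rw [hr0]; exact hρ0)).continuousAt
    filter_upwards [h2.eventually h1] with t ht
    exact ht.differentiableAt (by norm_num)
  have hFΦ : HasDerivAt (fun t => F (Φ t)) (A (Φ' 0)) 0 := by
    have h1 : HasFDerivAt F A (Φ 0) := by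
      rw [hΦ0, hA]; exact (hF.differentiableAt (by norm_num)).hasFDerivAt
    exact h1.comp_hasDerivAt (0:ℝ) (hΦd 0 (by rw [hr0]; exact hρ0))
  have hDF : HasDerivAt (fun t => fderiv ℝ F (Φ t) (Φ' t)) (H (Φ' 0) (Φ' 0) +
      A ((2 * (-(2 * μ * z j) / ρ ^ 2)) • ee j +
      (μ * (-2 / ρ ^ 2 + 8 * z j ^ 2 / ρ ^ 3)) • z)) 0 := by
    have h1 : HasFDerivAt (fderiv ℝ F) H (Φ 0) := by
      rw [hΦ0, hH]; exact (fd_diff hF).hasFDerivAt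
    have h2 := h1.comp_hasDerivAt (0:ℝ) (hΦd 0 (by rw [hr0]; exact hρ0))
    have h3 := h2.clm_apply hΦ'd
    refine h3.congr_deriv ?_
    simp [hA, hΦ0]
  have hfun : (fun t : ℝ => Kel σ l F (z + t • ee j)) =
      fun t : ℝ => (r t) ^ (-σ) * (c * F (Φ t)) := by
    ext t
    simp only [Kel, hΦ, hr]
    rw [normsq_line, ← hρ, ← hμ, ← hc]
  obtain ⟨h1, h2⟩ := line_lemma (e := ee j) (Kel_smooth (σ := σ) hz hF)
    (g := fun t => (-σ * (r t) ^ (-σ - 1) * (2 * z j + 2 * t)) * (c * F (Φ t)) +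
      (r t) ^ (-σ) * (c * fderiv ℝ F (Φ t) (Φ' t)))
    (by
      rw [hfun]
      filter_upwards [ha, hFev] with t h1 h2
      exact h1.2.mul ((h2.hasFDerivAt.comp_hasDerivAt t (hΦd t h1.1)).const_mul c))
    ((hb.mul (hFΦ.const_mul c)).add (ha.self_of_nhds.2.mul (hDF.const_mul c)))
  have e7 : ρ + 2 * z j * 0 + 0 ^ 2 = ρ := by ring
  rw [e7] at h2
  rw [h1, h2]
  have e1 : ρ ^ (-σ - 1) = X / ρ := by rw [hX, Real.rpow_sub_one hρ0.ne']
  have e2 : ρ ^ (-σ - 2) = X / ρ ^ 2 := by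
    rw [hX, Real.rpow_sub hρ0]; norm_num
  have e4 : fderiv ℝ F (Φ 0) = A := by rw [hΦ0, hA]
  have e5 : F (Φ 0) = Fz := by rw [hΦ0, hFz]
  have e6 : b j / z j * z j = b j := by
    by_cases hbj : b j = 0
    · simp [hbj]
    · exact div_mul_cancel₀ _ (hQ hbj)
  simp only [hr0, e4, e5, e1, e2, ← hX, hΦ'0, map_add, map_smul, add_apply,
    smul_apply, smul_eq_mul, mul_zero, add_zero]
  generalize A z = Az
  generalize A (ee j) = Aj
  generalize H z z = Hzz
  generalize H (ee j) z = Hjz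
  generalize H z (ee j) = Hzj
  generalize H (ee j) (ee j) = Hjj
  generalize hq : b j / z j = q at *
  rw [← e6]
  field_simp
  ring

lemma Kel_Lop {σ l : ℝ} {b : ι → ℝ} {F : EuclideanSpace ℝ ι → ℝ} {z : EuclideanSpace ℝ ι}
    (hl : 0 < l) (hz : z ≠ 0) (hF : ContDiffAt ℝ 2 F ((l ^ 2 / ‖z‖ ^ 2) • z)) (hQ : z ∈ QQ b)
    (hσ : 2 * σ + 2 = Fintype.card ι + ∑ j, b j) :
    Lop b (Kel σ l F) z = (‖z‖ ^ 2) ^ (-σ) * (l ^ (2 * σ) * ((l ^ 2 / ‖z‖ ^ 2) ^ 2 *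
      Lop b F ((l ^ 2 / ‖z‖ ^ 2) • z))) := by
  have hρ0 := ne_normsq hz
  unfold Lop
  rw [Finset.sum_congr rfl (fun j _ => Kel_term b hz hF j (hQ j) _ _ _ _ _ _ _ rfl rfl rfl rfl rfl rfl rfl)]
  simp only [Finset.sum_add_distrib, ← Finset.mul_sum, ← normsq, PiLp.smul_apply, smul_eq_mul]
  set A := fderiv ℝ F ((l ^ 2 / ‖z‖ ^ 2) • z) with hA
  set H := fderiv ℝ (fderiv ℝ F) ((l ^ 2 / ‖z‖ ^ 2) • z) with hH
  have s1 : ∑ j, z j * A (ee j) = A z := by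
    conv_rhs => rw [← sum_ee z]
    simp
  have s2 : ∑ j, z j * H (ee j) z = H z z := by
    have : H z z = H (∑ j, z j • ee j) z := by rw [sum_ee]
    rw [this]
    simp
  have s3 : ∑ j, z j * H z (ee j) = H z z := by
    have : H z z = H z (∑ j, z j • ee j) := by rw [sum_ee]
    rw [this]
    simp
  rw [s1, s2, s3]
  have s4 : ∑ j, b j / (l ^ 2 / ‖z‖ ^ 2 * z j) * A (ee j) =
      ‖z‖ ^ 2 / l ^ 2 * ∑ j, b j / z j * A (ee j) := by
    rw [Finset.mul_sum]
    apply Finset.sum_congr rfl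
    intro j _
    by_cases hbj : b j = 0
    · simp [hbj]
    have := hQ j hbj
    have hnz := norm_ne_zero_iff.2 hz
    field_simp
  rw [s4]
  simp only [Finset.sum_const, Finset.card_univ, nsmul_eq_mul]
  have hcard : (Fintype.card ι : ℝ) = 2 * σ + 2 - ∑ j, b j := by linarith
  rw [hcard]
  have hnz := norm_ne_zero_iff.2 hz
  generalize ∑ j, b j / z j * A (ee j) = S1
  generalize ∑ j, b j = B
  generalize ∑ j, H (ee j) (ee j) = S2
  generalize ((‖z‖ ^ 2) ^ (-σ)) = X
  generalize F ((l ^ 2 / ‖z‖ ^ 2) • z) = Fz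
  generalize l ^ (2 * σ) = c
  generalize A z = Az
  generalize H z z = Hz
  generalize ‖z‖ = ν at *
  field_simp
  ring

end LC


namespace LC
open Filter Topology
set_option linter.unusedSectionVars false
variable {ι : Type*} [DecidableEq ι] [Fintype ι]

/-- Entire nonnegative solutions of the lifted equation. -/
structure Sol (b : ι → ℝ) (σ : ℝ) (F : EuclideanSpace ℝ ι → ℝ) : Prop where
  hσ : 0 < σ
  hN : 2 * σ + 2 = Fintype.card ι + ∑ j, b j
  hb : ∀ j, 0 ≤ b j
  diff : Differentiable ℝ F
  c2 : ∀ z ∈ QQ b, ContDiffAt ℝ 2 F z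
  nonneg : ∀ z, 0 ≤ F z
  eqn : ∀ z ∈ QQ b, Lop b F z = -(F z) ^ ((σ + 2) / σ)

lemma Sol.trans {b : ι → ℝ} {σ : ℝ} {F : EuclideanSpace ℝ ι → ℝ} (h : Sol b σ F)
    {x : EuclideanSpace ℝ ι} (hx : x ∈ PP b) : Sol b σ (fun z => F (x + z)) := by
  have hQ : ∀ z ∈ QQ b, x + z ∈ QQ b := by
    intro z hz j hj
    simpa [hx j hj] using hz j hj
  refine ⟨h.hσ, h.hN, h.hb, ?_, ?_, fun z => h.nonneg _, ?_⟩
  · exact h.diff.comp ((differentiable_const x).add differentiable_id)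
  · intro z hz
    exact ContDiffAt.comp (f := fun z => x + z) z (h.c2 _ (hQ z hz)) (contDiffAt_const.add contDiffAt_id)
  · intro z hz
    rw [← h.eqn _ (hQ z hz)]
    unfold Lop
    apply Finset.sum_congr rfl
    intro j _
    have e1 : fderiv ℝ (fun z => F (x + z)) = fun z => fderiv ℝ F (x + z) := by
      ext z : 1
      exact fderiv_comp_add_left x
    rw [e1, fderiv_comp_add_left (f := fderiv ℝ F) x]
    by_cases hj : b j = 0
    · simp [hj]
    · simp [hx j hj]

lemma QQ_smul {b : ι → ℝ} {z : EuclideanSpace ℝ ι} (hz : z ∈ QQ b) {c : ℝ} (hc : c ≠ 0) :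
    c • z ∈ QQ b := by
  intro j hj
  simpa [hc] using hz j hj

lemma Kel_nonneg {b : ι → ℝ} {σ : ℝ} {F : EuclideanSpace ℝ ι → ℝ} (h : Sol b σ F) {l : ℝ}
    (hl : 0 ≤ l) (z : EuclideanSpace ℝ ι) : 0 ≤ Kel σ l F z := by
  unfold Kel
  have := h.nonneg ((l ^ 2 / ‖z‖ ^ 2) • z)
  positivity

lemma Kel_c2 {b : ι → ℝ} {σ : ℝ} {F : EuclideanSpace ℝ ι → ℝ} (h : Sol b σ F) {l : ℝ}
    (hl : 0 < l) {z : EuclideanSpace ℝ ι} (hz : z ≠ 0) (hQ : z ∈ QQ b) :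
    ContDiffAt ℝ 2 (Kel σ l F) z := by
  have := ne_normsq hz
  exact Kel_smooth hz (h.c2 _ (QQ_smul hQ (by positivity)))

lemma Kel_eq {b : ι → ℝ} {σ : ℝ} {F : EuclideanSpace ℝ ι → ℝ} (h : Sol b σ F) {l : ℝ}
    (hl : 0 < l) {z : EuclideanSpace ℝ ι} (hz : z ≠ 0) (hQ : z ∈ QQ b) :
    Lop b (Kel σ l F) z = -(Kel σ l F z) ^ ((σ + 2) / σ) := by
  have hρ := ne_normsq hz
  have hQ' : (l ^ 2 / ‖z‖ ^ 2) • z ∈ QQ b := QQ_smul hQ (by positivity)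
  rw [Kel_Lop hl hz (h.c2 _ hQ') hQ h.hN, h.eqn _ hQ']
  unfold Kel
  set ρ := ‖z‖ ^ 2
  have hF := h.nonneg ((l ^ 2 / ρ) • z)
  have hσ := h.hσ
  rw [Real.mul_rpow (by positivity) (by positivity), Real.mul_rpow (by positivity) hF,
    ← Real.rpow_mul hρ.le, ← Real.rpow_mul hl.le]
  have e1 : -σ * ((σ + 2) / σ) = -σ - 2 := by field_simp; ring
  have e2 : 2 * σ * ((σ + 2) / σ) = 2 * σ + 4 := by field_simp; ring
  rw [e1, e2, Real.rpow_sub hρ, Real.rpow_add hl]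
  norm_num
  field_simp

lemma w_Lop {b : ι → ℝ} {σ : ℝ} {F : EuclideanSpace ℝ ι → ℝ} (h : Sol b σ F) {l : ℝ}
    (hl : 0 < l) {z : EuclideanSpace ℝ ι} (hz : z ≠ 0) (hQ : z ∈ QQ b) :
    Lop b (fun z => F z - Kel σ l F z) z =
      (Kel σ l F z) ^ ((σ + 2) / σ) - (F z) ^ ((σ + 2) / σ) := by
  have h1 := Lop_lin (b := b) (h.c2 z hQ) (Kel_c2 h hl hz hQ) 1 (-1) 0
  have e : (fun z => F z - Kel σ l F z) = fun z => 1 * F z + (-1) * Kel σ l F z + 0 := by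
    ext z; ring
  rw [e, h1, h.eqn z hQ, Kel_eq h hl hz hQ]
  ring

lemma radial_harm {b : ι → ℝ} {σ : ℝ} {F : EuclideanSpace ℝ ι → ℝ} (h : Sol b σ F)
    {x z : EuclideanSpace ℝ ι} (hz : z ≠ x) (hx : x ∈ PP b) (hQ : z ∈ QQ b) :
    Lop b (fun z => (‖z - x‖ ^ 2) ^ (-σ)) z = 0 := by
  rw [radial_Lop hz hx hQ, ← h.hN]
  ring

lemma card_ne {b : ι → ℝ} {σ : ℝ} {F : EuclideanSpace ℝ ι → ℝ} (h : Sol b σ F)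
    (hP : ∃ x ∈ PP b, x ≠ 0) : Nonempty ι := by
  obtain ⟨x, -, hx⟩ := hP
  by_contra hne
  rw [not_nonempty_iff] at hne
  exact hx (by ext j; exact hne.elim j)

/-- compactness of annuli -/
lemma ann_compact (s T : ℝ) : IsCompact {z : EuclideanSpace ℝ ι | s ≤ ‖z‖ ∧ ‖z‖ ≤ T} := by
  have h1 : IsClosed {z : EuclideanSpace ℝ ι | s ≤ ‖z‖ ∧ ‖z‖ ≤ T} :=
    (isClosed_le continuous_const continuous_norm).inter
      (isClosed_le continuous_norm continuous_const)
  apply (isCompact_closedBall (0 : EuclideanSpace ℝ ι) T).of_isClosed_subset h1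
  intro z hz
  simpa using hz.2

lemma ann_open (s T : ℝ) : IsOpen {z : EuclideanSpace ℝ ι | s < ‖z‖ ∧ ‖z‖ < T} :=
  (isOpen_lt continuous_const continuous_norm).inter (isOpen_lt continuous_norm continuous_const)

lemma rpow_anti {σ x y : ℝ} (hσ : 0 < σ) (hx : 0 < x) (hxy : x ≤ y) : y ^ (-σ) ≤ x ^ (-σ) :=
  Real.rpow_le_rpow_of_nonpos hx hxy (by linarith)

lemma tends_rpow {σ : ℝ} (hσ : 0 < σ) (a : ℝ) :
    Tendsto (fun T : ℝ => ((T - a) ^ 2) ^ (-σ)) atTop (𝓝 0) := by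
  have h1 : Tendsto (fun T : ℝ => (T - a) ^ 2) atTop atTop :=
    (tendsto_pow_atTop (by norm_num)).comp (tendsto_atTop_add_const_right _ (-a) tendsto_id)
  exact (tendsto_rpow_neg_atTop hσ).comp h1

lemma lower_bound [Nonempty ι] {b : ι → ℝ} {σ : ℝ} {F : EuclideanSpace ℝ ι → ℝ} (h : Sol b σ F)
    (h0 : 0 < F 0) : ∀ R > 0, ∃ ε > 0, ∀ z, R ≤ ‖z‖ → ε * (‖z‖ ^ 2) ^ (-σ) ≤ F z := by
  intro R hR
  have hσ := h.hσ
  obtain ⟨s', hs', hsF⟩ : ∃ s > 0, ∀ z, ‖z‖ < s → F 0 / 2 < F z := by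
    have := (h.diff.continuous.tendsto 0).eventually_const_lt (show F 0 / 2 < F 0 by linarith)
    obtain ⟨s, hs, hh⟩ := Metric.eventually_nhds_iff.1 this
    exact ⟨s, hs, fun z hz => hh (by simpa using hz)⟩
  set s := min (s' / 2) R with hs
  have hs0 : 0 < s := by positivity
  set ε := F 0 / 2 * (s ^ 2) ^ σ with hε
  have hε0 : 0 < ε := by positivity
  have hzero : (0 : EuclideanSpace ℝ ι) ∈ PP b := fun j _ => rfl
  have key : ∀ T > s, ∀ z, s ≤ ‖z‖ → ‖z‖ ≤ T →
      0 ≤ F z + (-ε) * (‖z - 0‖ ^ 2) ^ (-σ) + ε * ((T - 0) ^ 2) ^ (-σ) := by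
    intro T hT z hz1 hz2
    have hne : ∀ z : EuclideanSpace ℝ ι, s ≤ ‖z‖ → z ≠ 0 := fun z hz hz' => by
      rw [hz', norm_zero] at hz; linarith
    refine MP h.hb (ann_compact s T) (ann_open s T) (fun z hz => ⟨hz.1.le, hz.2.le⟩)
      (w := fun z => F z + (-ε) * (‖z - 0‖ ^ 2) ^ (-σ) + ε * ((T - 0) ^ 2) ^ (-σ)) ?_ ?_ ?_ ?_ ?_ z ⟨hz1, hz2⟩
    · intro z hz
      exact ((h.diff z).continuousAt.add (continuousAt_const.mul
        (radial_smooth (hne z hz.1) (-σ)).continuousAt)).add continuousAt_const |>.continuousWithinAt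
    · intro z hz hzO
      have hcase : ‖z‖ = s ∨ ‖z‖ = T := by
        by_contra hcon
        push Not at hcon
        exact hzO ⟨lt_of_le_of_ne hz.1 (Ne.symm hcon.1), lt_of_le_of_ne hz.2 hcon.2⟩
      rcases hcase with hc | hc
      · have h1 := hsF z (by rw [hc]; exact lt_of_le_of_lt (min_le_left _ _) (by linarith))
        have h2 : ε * (s ^ 2) ^ (-σ) = F 0 / 2 := by
          rw [hε, mul_assoc, ← Real.rpow_add (by positivity)]; simp
        have h3 : 0 ≤ ε * ((T - 0) ^ 2) ^ (-σ) := by positivity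
        simp only [sub_zero] at *
        rw [hc]
        linarith
      · have := h.nonneg z
        simp only [sub_zero, hc]
        linarith
    · intro z hz
      exact ((h.diff z).add (((radial_smooth (hne z hz.1.le) (-σ)).differentiableAt
        (by norm_num)).const_mul _)).add_const _
    · intro z hz hQ
      exact ((h.c2 z hQ).add (contDiffAt_const.mul (radial_smooth (hne z hz.1.le) (-σ)))).add
        contDiffAt_const
    · intro z hz hQ _
      have h1 := Lop_lin (b := b) (h.c2 z hQ) (radial_smooth (hne z hz.1.le) (-σ)) 1 (-ε)
        (ε * ((T - 0) ^ 2) ^ (-σ))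
      rw [radial_harm h (hne z hz.1.le) hzero hQ, h.eqn z hQ] at h1
      simp only [one_mul] at h1
      rw [h1]
      have := h.nonneg z
      have : 0 ≤ F z ^ ((σ + 2) / σ) := by positivity
      linarith
  refine ⟨ε, hε0, fun z hz => ?_⟩
  have hsz : s ≤ ‖z‖ := (min_le_right _ _).trans hz
  have hlim : Tendsto (fun T : ℝ => F z + (-ε) * (‖z - 0‖ ^ 2) ^ (-σ) + ε * ((T - 0) ^ 2) ^ (-σ))
      atTop (𝓝 (F z + (-ε) * (‖z - 0‖ ^ 2) ^ (-σ) + ε * 0)) :=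
    ((tends_rpow hσ 0).const_mul ε).const_add _
  have := ge_of_tendsto hlim (by
    filter_upwards [eventually_gt_atTop s, eventually_ge_atTop ‖z‖] with T h1 h2
    exact key T h1 z hsz h2)
  simp only [sub_zero] at this
  linarith

lemma Kel_on_sphere {σ l : ℝ} {F : EuclideanSpace ℝ ι → ℝ} (hl : 0 < l)
    {z : EuclideanSpace ℝ ι} (hz : ‖z‖ = l) : Kel σ l F z = F z := by
  unfold Kel
  rw [hz, div_self (by positivity), one_smul, ← mul_assoc, ← Real.rpow_natCast,
    ← Real.rpow_mul hl.le, ← Real.rpow_add hl]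
  norm_num

lemma Kel_strict [Nonempty ι] {b : ι → ℝ} {σ : ℝ} {F : EuclideanSpace ℝ ι → ℝ} (h : Sol b σ F)
    {l : ℝ} (hl : 0 < l) (hle : ∀ z, l ≤ ‖z‖ → Kel σ l F z ≤ F z) {x : EuclideanSpace ℝ ι}
    (hx : x ∈ PP b) (hxl : l < ‖x‖) (hlt : Kel σ l F x < F x) :
    ∀ R > l, ∃ ε > 0, ∀ z, R ≤ ‖z‖ → ε * (‖z‖ ^ 2) ^ (-σ) ≤ F z - Kel σ l F z := by
  intro R hR
  have hσ := h.hσ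
  have hx0 : 0 < ‖x‖ := hl.trans hxl
  set w : EuclideanSpace ℝ ι → ℝ := fun z => F z - Kel σ l F z with hw
  have hne : ∀ z : EuclideanSpace ℝ ι, l ≤ ‖z‖ → z ≠ 0 := fun z hz hz' => by
      rw [hz', norm_zero] at hz; linarith
  have hwd : ∀ z, l ≤ ‖z‖ → DifferentiableAt ℝ w z := fun z hz =>
    (h.diff z).sub (Kel_diff (hne z hz) h.diff)
  have hw0 : ∀ z, l ≤ ‖z‖ → 0 ≤ w z := fun z hz => sub_nonneg.2 (hle z hz)
  have hwx : 0 < w x := sub_pos.2 hlt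
  obtain ⟨s, hs0, hsw⟩ : ∃ s > 0, ∀ z, ‖z - x‖ ≤ s → l < ‖z‖ ∧ w x / 2 < w z := by
    have h1 := (hwd x hxl.le).continuousAt.tendsto.eventually_const_lt
      (show w x / 2 < w x by linarith)
    have h2 := (continuous_norm.tendsto x).eventually_const_lt hxl
    obtain ⟨s, hs, hh⟩ := Metric.eventually_nhds_iff.1 (h2.and h1)
    refine ⟨s / 2, by positivity, fun z hz => hh ?_⟩
    rw [dist_eq_norm]; linarith
  set δ := w x / 2 with hδ
  have hδ0 : 0 < δ := by positivity
  set c := δ * (s ^ 2) ^ σ with hc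
  have hc0 : 0 < c := by positivity
  set x1 : EuclideanSpace ℝ ι := (l ^ 2 / ‖x‖ ^ 2) • x with hx1
  have hx1P : x1 ∈ PP b := fun j hj => by simp [hx1, hx j hj]
  have hx1n : ‖x1‖ < l := by
    rw [hx1, norm_smul, Real.norm_of_nonneg (by positivity)]
    have : l ^ 2 / ‖x‖ ^ 2 * ‖x‖ = l * (l / ‖x‖) := by field_simp
    rw [this]
    have : l / ‖x‖ < 1 := (div_lt_one hx0).2 hxl
    nlinarith
  have hne1 : ∀ z : EuclideanSpace ℝ ι, l ≤ ‖z‖ → z ≠ x1 := fun z hz hz' => by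
    rw [hz'] at hz; linarith
  set k := ‖x‖ ^ 2 / l ^ 2 with hk
  have hk1 : 1 < k := by
    rw [hk, one_lt_div (by positivity)]
    nlinarith
  have hAB : ∀ z, k * ‖z - x1‖ ^ 2 = ‖z - x‖ ^ 2 + (k - 1) * (‖z‖ ^ 2 - l ^ 2) := by
    intro z
    rw [@norm_sub_sq_real, @norm_sub_sq_real, hx1, inner_smul_right, norm_smul,
      Real.norm_of_nonneg (by positivity), hk]
    field_simp
    ring
  set G : EuclideanSpace ℝ ι → ℝ := fun z =>
    1 * (‖z - x‖ ^ 2) ^ (-σ) + (-(k ^ (-σ))) * (‖z - x1‖ ^ 2) ^ (-σ) + 0 with hG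
  have hGeq : ∀ z, G z = (‖z - x‖ ^ 2) ^ (-σ) -
      (‖z - x‖ ^ 2 + (k - 1) * (‖z‖ ^ 2 - l ^ 2)) ^ (-σ) := by
    intro z
    rw [← hAB z, Real.mul_rpow (by positivity) (by positivity), hG]
    ring
  have hGs : ∀ z, l ≤ ‖z‖ → z ≠ x → ContDiffAt ℝ 2 G z := fun z hz hzx =>
    ((contDiffAt_const.mul (radial_smooth hzx (-σ))).add
      (contDiffAt_const.mul (radial_smooth (hne1 z hz) (-σ)))).add contDiffAt_const
  have hGle : ∀ z, G z ≤ (‖z - x‖ ^ 2) ^ (-σ) := by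
    intro z
    have : 0 ≤ k ^ (-σ) * (‖z - x1‖ ^ 2) ^ (-σ) := by positivity
    simp only [hG]
    linarith
  have key : ∀ T > ‖x‖ + s, ∀ z, l ≤ ‖z‖ → ‖z‖ ≤ T → s ≤ ‖z - x‖ →
      0 ≤ 1 * w z + (-c) * G z + c * ((T - ‖x‖) ^ 2) ^ (-σ) := by
    intro T hT z hz1 hz2 hz3
    have hnx : ∀ z : EuclideanSpace ℝ ι, s ≤ ‖z - x‖ → z ≠ x := fun z hz hz' => by
      rw [hz', sub_self, norm_zero] at hz; linarith
    have hcl : IsClosed {z : EuclideanSpace ℝ ι | s ≤ ‖z - x‖} :=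
      isClosed_le continuous_const (by fun_prop)
    have hop : IsOpen {z : EuclideanSpace ℝ ι | s < ‖z - x‖} :=
      isOpen_lt continuous_const (by fun_prop)
    refine MP h.hb ((ann_compact l T).inter_right hcl) ((ann_open l T).inter hop)
      (fun z hz => ⟨⟨hz.1.1.le, hz.1.2.le⟩, (show s < ‖z - x‖ from hz.2).le⟩)
      (w := fun z => 1 * w z + (-c) * G z + c * ((T - ‖x‖) ^ 2) ^ (-σ)) ?_ ?_ ?_ ?_ ?_ z
      ⟨⟨hz1, hz2⟩, hz3⟩
    · intro z hz
      exact ((continuousAt_const.mul (hwd z hz.1.1).continuousAt).add (continuousAt_const.mul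
        (hGs z hz.1.1 (hnx z hz.2)).continuousAt)).add continuousAt_const |>.continuousWithinAt
    · intro z hz hzO
      have hcase : ‖z‖ = l ∨ ‖z‖ = T ∨ ‖z - x‖ = s := by
        by_contra hcon
        push Not at hcon
        exact hzO ⟨⟨lt_of_le_of_ne hz.1.1 (Ne.symm hcon.1), lt_of_le_of_ne hz.1.2 hcon.2.1⟩,
          lt_of_le_of_ne hz.2 (Ne.symm hcon.2.2)⟩
      have hwz := hw0 z hz.1.1
      have h3 : 0 ≤ c * ((T - ‖x‖) ^ 2) ^ (-σ) := by positivity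
      rcases hcase with hc' | hc' | hc'
      · have : G z = 0 := by rw [hGeq, hc']; simp
        simp only [this]
        linarith
      · have h4 : G z ≤ ((T - ‖x‖) ^ 2) ^ (-σ) := by
          refine (hGle z).trans (rpow_anti hσ ?_ ?_)
          · have : 0 < T - ‖x‖ := by linarith
            positivity
          · have := norm_sub_norm_le z x
            rw [hc'] at this
            have : 0 < T - ‖x‖ := by linarith
            gcongr
        have := mul_le_mul_of_nonneg_left h4 hc0.le
        linarith
      · have h2 : c * (s ^ 2) ^ (-σ) = δ := by
          rw [hc, mul_assoc, ← Real.rpow_add (by positivity)]; simp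
        have h4 := hGle z
        rw [hc'] at h4
        have h5 := mul_le_mul_of_nonneg_left h4 hc0.le
        have h6 := (hsw z hc'.le).2
        linarith
    · intro z hz
      exact (((hwd z hz.1.1.le).const_mul _).add (((hGs z hz.1.1.le (hnx z (show s < ‖z - x‖ from hz.2).le)).differentiableAt
        (by norm_num)).const_mul _)).add_const _
    · intro z hz hQ
      exact ((contDiffAt_const.mul ((h.c2 z hQ).sub (Kel_c2 h hl (hne z hz.1.1.le) hQ))).add
        (contDiffAt_const.mul (hGs z hz.1.1.le (hnx z (show s < ‖z - x‖ from hz.2).le)))).add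
        contDiffAt_const
    · intro z hz hQ _
      have hzl := hz.1.1.le
      have hzx := hnx z (show s < ‖z - x‖ from hz.2).le
      rw [Lop_lin (b := b) ((h.c2 z hQ).sub (Kel_c2 h hl (hne z hzl) hQ)) (hGs z hzl hzx)]
      rw [hG, Lop_lin (radial_smooth hzx (-σ)) (radial_smooth (hne1 z hzl) (-σ)),
        radial_harm h hzx hx hQ, radial_harm h (hne1 z hzl) hx1P hQ, w_Lop h hl (hne z hzl) hQ]
      have := Real.rpow_le_rpow (Kel_nonneg h hl.le z) (hle z hzl)
        (show 0 ≤ (σ + 2) / σ by positivity)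
      linarith
  have key2 : ∀ z, l ≤ ‖z‖ → s ≤ ‖z - x‖ → c * G z ≤ w z := by
    intro z hz1 hz3
    have hlim : Tendsto (fun T : ℝ => 1 * w z + (-c) * G z + c * ((T - ‖x‖) ^ 2) ^ (-σ))
        atTop (𝓝 (1 * w z + (-c) * G z + c * 0)) :=
      ((tends_rpow hσ ‖x‖).const_mul c).const_add _
    have := ge_of_tendsto hlim (by
      filter_upwards [eventually_gt_atTop (‖x‖ + s), eventually_ge_atTop ‖z‖] with T h1 h2
      exact key T h1 z hz1 h2 hz3)
    linarith
  have hR0 : 0 < R := hl.trans hR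
  set C := (1 + ‖x‖ / R) ^ 2 with hC
  have hC0 : 0 < C := by positivity
  set η := (k - 1) * (1 - l ^ 2 / R ^ 2) / C with hη
  have hlR : l ^ 2 / R ^ 2 < 1 := by
    rw [div_lt_one (by positivity)]; nlinarith
  have hη0 : 0 < η := by
    apply div_pos _ hC0
    apply mul_pos <;> linarith
  set θ := 1 - (1 + η) ^ (-σ) with hθ
  have hθ0 : 0 < θ := by
    have : (1 + η) ^ (-σ) < 1 := Real.rpow_lt_one_of_one_lt_of_neg (by linarith) (by linarith)
    linarith
  refine ⟨min (δ * (l ^ 2) ^ σ) (c * (C ^ (-σ) * θ)), by positivity, fun z hz => ?_⟩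
  have hlz : l ≤ ‖z‖ := by linarith
  have hz0 : 0 < ‖z‖ := by linarith
  have hX : 0 ≤ (‖z‖ ^ 2) ^ (-σ) := by positivity
  by_cases hzs : ‖z - x‖ ≤ s
  · calc _ ≤ (δ * (l ^ 2) ^ σ) * (‖z‖ ^ 2) ^ (-σ) := by gcongr; exact min_le_left _ _
      _ ≤ (δ * (l ^ 2) ^ σ) * (l ^ 2) ^ (-σ) := by
        gcongr ?_ * ?_
        exact rpow_anti hσ (by positivity) (by gcongr)
      _ = δ := by rw [mul_assoc, ← Real.rpow_add (by positivity)]; simp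
      _ ≤ _ := (hsw z hzs).2.le
  · push Not at hzs
    have hA0 : 0 < ‖z - x‖ ^ 2 := by
      have : 0 < ‖z - x‖ := by linarith
      positivity
    have hAC : ‖z - x‖ ^ 2 ≤ C * ‖z‖ ^ 2 := by
      rw [hC, ← mul_pow]
      gcongr
      have h1 := norm_sub_le z x
      have : ‖x‖ ≤ ‖x‖ / R * ‖z‖ := by
        rw [div_mul_eq_mul_div, le_div_iff₀ hR0]
        gcongr
      linarith
    have hB : (1 + η) * ‖z - x‖ ^ 2 ≤ ‖z - x‖ ^ 2 + (k - 1) * (‖z‖ ^ 2 - l ^ 2) := by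
      have h1 : η * ‖z - x‖ ^ 2 ≤ η * (C * ‖z‖ ^ 2) := by gcongr
      have h2 : η * (C * ‖z‖ ^ 2) = (k - 1) * (‖z‖ ^ 2 - l ^ 2 / R ^ 2 * ‖z‖ ^ 2) := by
        rw [hη]; field_simp
      have h3 : l ^ 2 ≤ l ^ 2 / R ^ 2 * ‖z‖ ^ 2 := by
        rw [div_mul_eq_mul_div, le_div_iff₀ (by positivity)]
        gcongr
      have h4 : (k - 1) * (‖z‖ ^ 2 - l ^ 2 / R ^ 2 * ‖z‖ ^ 2) ≤ (k - 1) * (‖z‖ ^ 2 - l ^ 2) := by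
        apply mul_le_mul_of_nonneg_left _ (by linarith)
        linarith
      linarith
    have hGl : C ^ (-σ) * θ * (‖z‖ ^ 2) ^ (-σ) ≤ G z := by
      rw [hGeq]
      have h1 := rpow_anti hσ (by positivity) hB
      rw [Real.mul_rpow (by positivity) (by positivity)] at h1
      have h2 := rpow_anti hσ hA0 hAC
      rw [Real.mul_rpow (by positivity) (by positivity)] at h2
      have h3 := mul_le_mul_of_nonneg_right h2 hθ0.le
      have h4 : (‖z - x‖ ^ 2) ^ (-σ) * θ = (‖z - x‖ ^ 2) ^ (-σ) - (1 + η) ^ (-σ) * (‖z - x‖ ^ 2) ^ (-σ) := by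
        rw [hθ]; ring
      linarith
    calc _ ≤ (c * (C ^ (-σ) * θ)) * (‖z‖ ^ 2) ^ (-σ) := by gcongr; exact min_le_right _ _
      _ = c * (C ^ (-σ) * θ * (‖z‖ ^ 2) ^ (-σ)) := by ring
      _ ≤ c * G z := by gcongr
      _ ≤ w z := key2 z hlz hzs.le

end LC


namespace LC
open Filter Topology
set_option linter.unusedSectionVars false
variable {ι : Type*} [DecidableEq ι] [Fintype ι]

lemma pow_ineq {α f k M : ℝ} (hα : 1 ≤ α) (hf : 0 ≤ f) (hfk : f ≤ k) (hkM : k ≤ M) :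
    k ^ α - f ^ α ≤ α * M ^ (α - 1) * (k - f) := by
  rcases eq_or_lt_of_le (hf.trans hfk) with hk | hk
  · have : f = 0 := le_antisymm (hk ▸ hfk) hf
    rw [← hk, this]; simp
  have h1 := one_add_mul_self_le_rpow_one_add (s := f / k - 1) (by
    have : 0 ≤ f / k := by positivity
    linarith) hα
  have e : 1 + (f / k - 1) = f / k := by ring
  rw [e, Real.div_rpow hf hk.le] at h1
  have hka : 0 < k ^ α := by positivity
  rw [le_div_iff₀ hka] at h1
  have e2 : k ^ α = k ^ (α - 1) * k := by
    rw [← Real.rpow_add_one hk.ne']; ring_nf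
  have h2 : k ^ α - f ^ α ≤ α * k ^ (α - 1) * (k - f) := by
    have : (1 + α * (f / k - 1)) * k ^ α = k ^ α - α * k ^ (α - 1) * (k - f) := by
      rw [e2]; field_simp; ring
    linarith
  have h3 : k ^ (α - 1) ≤ M ^ (α - 1) := Real.rpow_le_rpow hk.le hkM (by linarith)
  have : α * k ^ (α - 1) * (k - f) ≤ α * M ^ (α - 1) * (k - f) := by
    have : 0 ≤ k - f := by linarith
    have : 0 ≤ α := by linarith
    gcongr
  linarith

lemma Kel_le {σ M l : ℝ} (hσ : 0 < σ) (hl : 0 < l) {F : EuclideanSpace ℝ ι → ℝ} (hM0 : 0 ≤ M)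
    (hM : ∀ z, ‖z‖ ≤ l → F z ≤ M) {z : EuclideanSpace ℝ ι} (hz : l ≤ ‖z‖) : Kel σ l F z ≤ M := by
  have hz0 : 0 < ‖z‖ := hl.trans_le hz
  have h1 : F ((l ^ 2 / ‖z‖ ^ 2) • z) ≤ M := by
    apply hM
    rw [norm_smul, Real.norm_of_nonneg (by positivity)]
    have : l ^ 2 / ‖z‖ ^ 2 * ‖z‖ = l * (l / ‖z‖) := by field_simp
    rw [this]
    have : l / ‖z‖ ≤ 1 := (div_le_one hz0).2 hz
    nlinarith
  have h2 : (‖z‖ ^ 2) ^ (-σ) * l ^ (2 * σ) ≤ 1 := by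
    have : l ^ (2 * σ) = (l ^ 2) ^ σ := by
      rw [← Real.rpow_natCast, ← Real.rpow_mul hl.le]; norm_num
    rw [this, Real.rpow_neg (by positivity), inv_mul_le_one₀ (by positivity)]
    gcongr
  unfold Kel
  rw [← mul_assoc]
  have h3 : 0 ≤ (‖z‖ ^ 2) ^ (-σ) * l ^ (2 * σ) := by positivity
  nlinarith

lemma narrow [Nonempty ι] {b : ι → ℝ} {σ : ℝ} {F : EuclideanSpace ℝ ι → ℝ} (h : Sol b σ F)
    {l0 l R M : ℝ} (hl0 : 0 ≤ l0) (hl0l : l0 ≤ l) (hl : 0 < l) (hlR : l < R) (hM0 : 0 ≤ M)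
    (hM : ∀ z, ‖z‖ ≤ R → F z ≤ M)
    (hnar : (σ + 2) / σ * M ^ ((σ + 2) / σ - 1) * (2 * (R ^ 2 - l0 ^ 2)) ≤ 2 * σ + 2)
    (hbd : ∀ z, ‖z‖ = R → Kel σ l F z ≤ F z) :
    ∀ z, l ≤ ‖z‖ → ‖z‖ ≤ R → Kel σ l F z ≤ F z := by
  have hσ := h.hσ
  set α := (σ + 2) / σ with hα
  have hα1 : 1 ≤ α := by rw [hα, one_le_div hσ]; linarith
  set w : EuclideanSpace ℝ ι → ℝ := fun z => F z - Kel σ l F z with hw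
  set B := 2 * R ^ 2 - l0 ^ 2 with hB
  have hne : ∀ z : EuclideanSpace ℝ ι, l ≤ ‖z‖ → z ≠ 0 := fun z hz hz' => by
      rw [hz', norm_zero] at hz; linarith
  have hwd : ∀ z, l ≤ ‖z‖ → DifferentiableAt ℝ w z := fun z hz =>
    (h.diff z).sub (Kel_diff (hne z hz) h.diff)
  have hd : 0 < R ^ 2 - l0 ^ 2 := by nlinarith
  have hg1 : ∀ z : EuclideanSpace ℝ ι, ‖z‖ ≤ R → R ^ 2 - l0 ^ 2 ≤ B - ‖z‖ ^ 2 := fun z hz => by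
    have : ‖z‖ ^ 2 ≤ R ^ 2 := by gcongr
    linarith
  have hg2 : ∀ z : EuclideanSpace ℝ ι, l ≤ ‖z‖ → B - ‖z‖ ^ 2 ≤ 2 * (R ^ 2 - l0 ^ 2) := fun z hz => by
    have : l0 ^ 2 ≤ ‖z‖ ^ 2 := by
      have := hl0l.trans hz
      gcongr
    linarith
  intro z0 hz01 hz02
  obtain ⟨zm, hzm, hmax⟩ := (ann_compact (ι := ι) l R).exists_isMaxOn ⟨z0, hz01, hz02⟩
    (f := fun z => - w z / (B - ‖z‖ ^ 2)) (by
      intro z hz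
      have := hg1 z hz.2
      exact ((hwd z hz.1).continuousAt.neg.div (by fun_prop) (by linarith)).continuousWithinAt)
  set κ := - w zm / (B - ‖zm‖ ^ 2) with hκ
  have hle : ∀ z, l ≤ ‖z‖ → ‖z‖ ≤ R → - w z ≤ κ * (B - ‖z‖ ^ 2) := fun z h1 h2 => by
    have h3 := hmax ⟨h1, h2⟩
    simp only [Set.mem_ofPred_eq] at h3
    have h4 := hg1 z h2
    exact (div_le_iff₀ (by linarith)).1 h3
  by_cases hκ0 : κ ≤ 0
  · have h1 := hle z0 hz01 hz02
    have h2 := hg1 z0 hz02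
    have : κ * (B - ‖z0‖ ^ 2) ≤ 0 := mul_nonpos_of_nonpos_of_nonneg hκ0 (by linarith)
    have : 0 ≤ F z0 - Kel σ l F z0 := by simp only [hw] at h1; linarith
    linarith
  push Not at hκ0
  exfalso
  have hzero : (0 : EuclideanSpace ℝ ι) ∈ PP b := fun j _ => rfl
  have hgs : ∀ z : EuclideanSpace ℝ ι, l ≤ ‖z‖ → ContDiffAt ℝ 2 (fun z => (‖z - 0‖ ^ 2) ^ (1:ℝ)) z :=
    fun z hz => radial_smooth (hne z hz) 1
  have key := MP h.hb (ann_compact (ι := ι) l R) (ann_open l R)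
      (fun z hz => ⟨hz.1.le, hz.2.le⟩)
      (w := fun z => 1 * w z + (-(κ / 2)) * (‖z - 0‖ ^ 2) ^ (1:ℝ) + (κ / 2) * B) ?_ ?_ ?_ ?_ ?_ zm hzm
  · simp only [sub_zero, Real.rpow_one] at key
    have h1 := hg1 zm hzm.2
    have h2 : - w zm = κ * (B - ‖zm‖ ^ 2) := by rw [hκ]; field_simp [(by linarith : B - ‖zm‖ ^ 2 ≠ 0)]
    have : 0 < κ * (B - ‖zm‖ ^ 2) := mul_pos hκ0 (by linarith)
    linarith
  · intro z hz
    exact ((continuousAt_const.mul (hwd z hz.1).continuousAt).add (continuousAt_const.mul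
        (hgs z hz.1).continuousAt)).add continuousAt_const |>.continuousWithinAt
  · intro z hz hzO
    have hcase : ‖z‖ = l ∨ ‖z‖ = R := by
      by_contra hcon
      push Not at hcon
      exact hzO ⟨lt_of_le_of_ne hz.1 (Ne.symm hcon.1), lt_of_le_of_ne hz.2 hcon.2⟩
    have hwz : 0 ≤ w z := by
      rcases hcase with hc | hc
      · simp [hw, Kel_on_sphere hl hc]
      · exact sub_nonneg.2 (hbd z hc)
    have h1 := hg1 z hz.2
    have : 0 < κ * (B - ‖z‖ ^ 2) := mul_pos hκ0 (by linarith)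
    simp only [sub_zero, Real.rpow_one]
    linarith
  · intro z hz
    exact (((hwd z hz.1.le).const_mul _).add (((hgs z hz.1.le).differentiableAt
        (by norm_num)).const_mul _)).add_const _
  · intro z hz hQ
    exact ((contDiffAt_const.mul ((h.c2 z hQ).sub (Kel_c2 h hl (hne z hz.1.le) hQ))).add
        (contDiffAt_const.mul (hgs z hz.1.le))).add contDiffAt_const
  · intro z hz hQ hneg
    have hzl := hz.1.le
    rw [Lop_lin (b := b) ((h.c2 z hQ).sub (Kel_c2 h hl (hne z hzl) hQ)) (hgs z hzl),
      w_Lop h hl (hne z hzl) hQ, radial_Lop (hne z hzl) hzero hQ, ← h.hN]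
    simp only [sub_zero, Real.rpow_one] at hneg
    have h1 := hg1 z hz.2.le
    have h1' : 0 < κ * (B - ‖z‖ ^ 2) := mul_pos hκ0 (by linarith)
    have hwneg : F z - Kel σ l F z < 0 := by
      have : w z < 0 := by linarith
      exact this
    have h2 := pow_ineq hα1 (h.nonneg z) (by linarith : F z ≤ Kel σ l F z)
      (Kel_le hσ hl hM0 (fun z hz => hM z (by linarith)) hzl)
    have h3 := hle z hzl hz.2.le
    have h4 := hg2 z hzl
    have hC0 : 0 ≤ α * M ^ (α - 1) := by positivity
    have h5 : α * M ^ (α - 1) * (Kel σ l F z - F z) ≤ α * M ^ (α - 1) * (κ * (2 * (R ^ 2 - l0 ^ 2))) := by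
      apply mul_le_mul_of_nonneg_left _ hC0
      have : κ * (B - ‖z‖ ^ 2) ≤ κ * (2 * (R ^ 2 - l0 ^ 2)) := by gcongr
      simp only [hw] at h3
      linarith
    have h6 := mul_le_mul_of_nonneg_left hnar hκ0.le
    norm_num
    linarith

end LC


namespace LC
open Filter Topology
set_option linter.unusedSectionVars false
variable {ι : Type*} [DecidableEq ι] [Fintype ι]

lemma Hcont {σ : ℝ} {F : EuclideanSpace ℝ ι → ℝ} (hσ : 0 < σ) (hF : Continuous F) :
    Continuous (fun p : EuclideanSpace ℝ ι × ℝ => p.2 ^ (2 * σ) * F (p.2 ^ 2 • p.1)) := by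
  have h1 : Continuous (fun p : EuclideanSpace ℝ ι × ℝ => p.2 ^ (2 * σ)) :=
    continuous_snd.rpow_const (fun _ => Or.inr (by positivity))
  exact h1.mul (hF.comp (by fun_prop))

lemma ext_lemma [Nonempty ι] {b : ι → ℝ} {σ : ℝ} {F : EuclideanSpace ℝ ι → ℝ} (h : Sol b σ F)
    {l0 : ℝ} (hl0 : 0 ≤ l0)
    (H : ∀ R > l0, ∃ ε > 0, ∀ z, R ≤ ‖z‖ → ε * (‖z‖ ^ 2) ^ (-σ) ≤ F z - Kel σ l0 F z) :
    ∃ l1 > l0, ∀ l, l0 < l → l ≤ l1 → ∀ z, l ≤ ‖z‖ → Kel σ l F z ≤ F z := by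
  have hσ := h.hσ
  have hFc := h.diff.continuous
  obtain ⟨M, hM⟩ := (isCompact_closedBall (0 : EuclideanSpace ℝ ι) (l0 + 1)).bddAbove_image
    hFc.continuousOn
  have hM' : ∀ z : EuclideanSpace ℝ ι, ‖z‖ ≤ l0 + 1 → F z ≤ M := fun z hz =>
    hM ⟨z, by simpa using hz, rfl⟩
  have hM0 : 0 ≤ M := (h.nonneg 0).trans (hM' 0 (by simp; linarith))
  set C := (σ + 2) / σ * M ^ ((σ + 2) / σ - 1) with hC
  have hev : ∀ᶠ R in 𝓝[>] l0, C * (2 * (R ^ 2 - l0 ^ 2)) < 2 * σ + 2 ∧ R < l0 + 1 ∧ l0 < R := by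
    have hc : Continuous (fun R : ℝ => C * (2 * (R ^ 2 - l0 ^ 2))) := by fun_prop
    have h1 := (hc.tendsto l0).eventually_lt_const (show _ < 2 * σ + 2 by simp; linarith)
    have h2 : ∀ᶠ R in 𝓝 l0, R < l0 + 1 := eventually_lt_nhds (by linarith)
    filter_upwards [h1.filter_mono nhdsWithin_le_nhds, h2.filter_mono nhdsWithin_le_nhds,
      self_mem_nhdsWithin] with R h1 h2 h3 using ⟨h1, h2, h3⟩
  obtain ⟨R, hR1, hR2, hR3⟩ := hev.exists
  have hR0 : 0 < R := by linarith
  obtain ⟨ε, hε, hεR⟩ := H R hR3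
  have hHc := Hcont hσ hFc
  have htube : ∀ᶠ l in 𝓝 l0, ∀ ζ ∈ Metric.closedBall (0 : EuclideanSpace ℝ ι) (1 / R),
      l ^ (2 * σ) * F (l ^ 2 • ζ) < l0 ^ (2 * σ) * F (l0 ^ 2 • ζ) + ε := by
    apply (isCompact_closedBall (0 : EuclideanSpace ℝ ι) (1 / R)).eventually_forall_of_forall_eventually
    intro ζ _
    have hd : Continuous (fun p : ℝ × EuclideanSpace ℝ ι => p.1 ^ (2 * σ) * F (p.1 ^ 2 • p.2)
        - l0 ^ (2 * σ) * F (l0 ^ 2 • p.2)) :=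
      (hHc.comp (continuous_snd.prodMk continuous_fst)).sub
        (continuous_const.mul (hFc.comp (by fun_prop)))
    have := (hd.tendsto (l0, ζ)).eventually_lt_const (show _ < ε by simpa using hε)
    filter_upwards [this] with p hp
    linarith
  obtain ⟨δ, hδ, hδH⟩ := Metric.eventually_nhds_iff.1 htube
  refine ⟨min (l0 + δ / 2) ((l0 + R) / 2), lt_min (by linarith) (by linarith), ?_⟩
  intro l hl hl1
  have hla := hl1.trans (min_le_left _ _)
  have hlb := hl1.trans (min_le_right _ _)
  have hl0' : 0 < l := by linarith
  have far : ∀ z : EuclideanSpace ℝ ι, R ≤ ‖z‖ → Kel σ l F z ≤ F z := by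
    intro z hz
    have hz0 : 0 < ‖z‖ := by linarith
    have h1 := hδH (y := l) (by rw [Real.dist_eq, abs_of_pos (by linarith)]; linarith)
      ((1 / ‖z‖ ^ 2) • z) (by
        rw [mem_closedBall_zero_iff, norm_smul, Real.norm_of_nonneg (by positivity)]
        have : 1 / ‖z‖ ^ 2 * ‖z‖ = 1 / ‖z‖ := by field_simp
        rw [this]
        gcongr)
    have e : ∀ l : ℝ, l ^ 2 • (1 / ‖z‖ ^ 2) • z = (l ^ 2 / ‖z‖ ^ 2) • z := fun l => by
      rw [smul_smul]; ring_nf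
    rw [e, e] at h1
    have h2 := hεR z hz
    have h3 := mul_le_mul_of_nonneg_left h1.le (show 0 ≤ (‖z‖ ^ 2) ^ (-σ) by positivity)
    unfold Kel at h2 ⊢
    linarith
  intro z hz
  rcases le_total R ‖z‖ with h1 | h1
  · exact far z h1
  · exact narrow h hl0 hl.le hl0' (by linarith) hM0 (fun z hz => hM' z (by linarith)) hR1.le
      (fun z hz => far z hz.ge) z hz h1

lemma dich [Nonempty ι] {b : ι → ℝ} {σ : ℝ} {F : EuclideanSpace ℝ ι → ℝ} (h : Sol b σ F)
    (h0 : 0 < F 0) :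
    (∀ l > 0, ∀ z, l ≤ ‖z‖ → Kel σ l F z ≤ F z) ∨
    ∃ l > 0, ∀ x ∈ PP b, l ≤ ‖x‖ → Kel σ l F x = F x := by
  have hσ := h.hσ
  by_contra hcon
  push Not at hcon
  obtain ⟨⟨L, hL, zL, hzL, hLlt⟩, h2⟩ := hcon
  set S : Set ℝ := {l | 0 < l ∧ ∀ μ, 0 < μ → μ ≤ l → ∀ z, μ ≤ ‖z‖ → Kel σ μ F z ≤ F z} with hS
  have hne : S.Nonempty := by
    obtain ⟨l1, hl1, hh⟩ := ext_lemma h le_rfl (by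
      intro R hR
      obtain ⟨ε, hε, hh⟩ := lower_bound h h0 R hR
      refine ⟨ε, hε, fun z hz => ?_⟩
      have : Kel σ 0 F z = 0 := by
        unfold Kel; rw [Real.zero_rpow (by positivity)]; simp
      rw [this, sub_zero]; exact hh z hz)
    exact ⟨l1, hl1, fun μ h1 h2 => hh μ h1 h2⟩
  have hbd : BddAbove S := ⟨L, fun l hl => by
    by_contra hc
    push Not at hc
    exact absurd (hl.2 L hL hc.le zL hzL) (not_le.2 hLlt)⟩
  set B := sSup S with hB
  obtain ⟨s0, hs0⟩ := hne
  have hB0 : 0 < B := hs0.1.trans_le (le_csSup hbd hs0)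
  have hlt : ∀ μ, 0 < μ → μ < B → ∀ z, μ ≤ ‖z‖ → Kel σ μ F z ≤ F z := by
    intro μ h1 h2
    obtain ⟨l, hl, hml⟩ := exists_lt_of_lt_csSup ⟨s0, hs0⟩ h2
    exact hl.2 μ h1 hml.le
  have hBB : ∀ z, B ≤ ‖z‖ → Kel σ B F z ≤ F z := by
    intro z hz
    have hc : Continuous (fun l : ℝ => Kel σ l F z) := by
      unfold Kel
      exact continuous_const.mul ((continuous_id.rpow_const (fun _ => Or.inr (by positivity))).mul
        (h.diff.continuous.comp (by fun_prop)))
    have ht : Tendsto (fun l : ℝ => Kel σ l F z) (𝓝[<] B) (𝓝 (Kel σ B F z)) :=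
      (hc.tendsto B).mono_left nhdsWithin_le_nhds
    refine le_of_tendsto ht ?_
    filter_upwards [self_mem_nhdsWithin, (eventually_gt_nhds hB0).filter_mono nhdsWithin_le_nhds]
      with μ h1 h2
    exact hlt μ h2 h1 z ((le_of_lt h1).trans hz)
  obtain ⟨x, hxP, hxB, hxne⟩ := h2 B hB0
  have hxl : B < ‖x‖ := lt_of_le_of_ne hxB (fun he => hxne (Kel_on_sphere hB0 he.symm))
  obtain ⟨l1, hl1, hh⟩ := ext_lemma h hB0.le
    (Kel_strict h hB0 hBB hxP hxl (lt_of_le_of_ne (hBB x hxB) hxne))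
  have : l1 ∈ S := by
    refine ⟨hB0.trans hl1, fun μ h1 h2 => ?_⟩
    rcases lt_trichotomy μ B with hc | hc | hc
    · exact hlt μ h1 hc
    · rw [hc]; exact hBB
    · exact hh μ hc h2
  exact absurd (le_csSup hbd this) (not_le.2 hl1)

end LC


namespace LC
open Filter Topology
set_option linter.unusedSectionVars false
section absV
variable {E : Type*} [NormedAddCommGroup E] [InnerProductSpace ℝ E]

/-- rescaled Kelvin reflection along a ray -/
noncomputable def Phi (V : E → ℝ) (x : E) (l : ℝ) (h : E) (r : ℝ) : ℝ :=
  (‖h - r • x‖ ^ 2 / l ^ 2) * V (x + (l ^ 2 * r / ‖h - r • x‖ ^ 2) • (h - r • x))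

lemma Phi_zero (V : E → ℝ) (x : E) (l : ℝ) (h : E) : Phi V x l h 0 = ‖h‖ ^ 2 / l ^ 2 * V x := by
  simp [Phi]

lemma Phi_deriv {V : E → ℝ} (hV : Differentiable ℝ V) (x : E) {l : ℝ} (hl : 0 < l) {h : E}
    (hh : h ≠ 0) :
    HasDerivAt (Phi V x l h) (fderiv ℝ V x h - 2 * (V x / l ^ 2) * inner ℝ x h) 0 := by
  have hn : 0 < ‖h‖ := norm_pos_iff.2 hh
  have h1 : HasDerivAt (fun r : ℝ => h - r • x) (-x) 0 := by
    have := ((hasDerivAt_id (0:ℝ)).smul_const x).const_sub h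
    exact this.congr_deriv (by simp)
  have hq : HasDerivAt (fun r : ℝ => ‖h - r • x‖ ^ 2) (-2 * inner ℝ x h) 0 := by
    refine h1.norm_sq.congr_deriv ?_
    simp [real_inner_comm]
  have hc : HasDerivAt (fun r : ℝ => l ^ 2 * r / ‖h - r • x‖ ^ 2) (l ^ 2 / ‖h‖ ^ 2) 0 := by
    have := ((hasDerivAt_id (0:ℝ)).const_mul (l ^ 2)).div hq (by simp; positivity)
    refine this.congr_deriv ?_
    simp
    field_simp
  have hs : HasDerivAt (fun r : ℝ => x + (l ^ 2 * r / ‖h - r • x‖ ^ 2) • (h - r • x))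
      ((l ^ 2 / ‖h‖ ^ 2) • h) 0 := by
    have := (hc.smul h1).const_add x
    refine this.congr_deriv ?_
    simp
  have hv : HasDerivAt (fun r : ℝ => V (x + (l ^ 2 * r / ‖h - r • x‖ ^ 2) • (h - r • x)))
      (fderiv ℝ V x ((l ^ 2 / ‖h‖ ^ 2) • h)) 0 := by
    have := (hV (x + (l ^ 2 * 0 / ‖h - (0:ℝ) • x‖ ^ 2) • (h - (0:ℝ) • x))).hasFDerivAt.comp_hasDerivAt
      (0:ℝ) hs
    refine this.congr_deriv ?_
    simp
  have := (hq.div_const (l ^ 2)).mul hv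
  refine this.congr_deriv ?_
  simp
  field_simp
  ring

/-- ray asymptotics, geometric identity -/
lemma Phi_geom (V : E → ℝ) (x : E) {l : ℝ} (h : E) {r : ℝ} (hr : 0 < r) :
    ‖(1 / r) • h - x‖ ^ 2 * V (x + (l ^ 2 / ‖(1 / r) • h - x‖ ^ 2) • ((1 / r) • h - x)) * r ^ 2 =
      ‖h - r • x‖ ^ 2 * V (x + (l ^ 2 * r / ‖h - r • x‖ ^ 2) • (h - r • x)) := by
  have e : (1 / r) • h - x = (1 / r) • (h - r • x) := by
    rw [smul_sub, smul_smul, one_div_mul_cancel hr.ne', one_smul]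
  rw [e, norm_smul, Real.norm_of_nonneg (by positivity), smul_smul]
  have e2 : l ^ 2 / (1 / r * ‖h - r • x‖) ^ 2 * (1 / r) = l ^ 2 * r / ‖h - r • x‖ ^ 2 := by
    field_simp
  rw [e2]
  field_simp

lemma ray_far (x : E) (l : ℝ) {h : E} (hh : h ≠ 0) :
    ∀ᶠ r : ℝ in 𝓝[>] 0, 0 < r ∧ l ≤ ‖(1 / r) • h - x‖ := by
  have hn : 0 < ‖h‖ := norm_pos_iff.2 hh
  have h1 : Tendsto (fun r : ℝ => r⁻¹ * ‖h‖) (𝓝[>] 0) atTop :=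
    tendsto_inv_nhdsGT_zero.atTop_mul_const hn
  filter_upwards [h1.eventually_ge_atTop (l + ‖x‖), self_mem_nhdsWithin] with r h2 h3
  have h3' : 0 < r := h3
  refine ⟨h3', ?_⟩
  have := norm_sub_norm_le ((1 / r) • h) x
  rw [norm_smul, Real.norm_of_nonneg (by positivity), one_div] at this
  rw [one_div]
  linarith

def Alt1 (V : E → ℝ) (x : E) : Prop := ∀ l > 0, ∀ z, l ≤ ‖z - x‖ →
  V z * l ^ 2 ≤ ‖z - x‖ ^ 2 * V (x + (l ^ 2 / ‖z - x‖ ^ 2) • (z - x))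

def Alt2 (V : E → ℝ) (x : E) (l : ℝ) : Prop := ∀ z, l ≤ ‖z - x‖ →
  V z * l ^ 2 = ‖z - x‖ ^ 2 * V (x + (l ^ 2 / ‖z - x‖ ^ 2) • (z - x))

lemma ray_alt2 {V : E → ℝ} {x : E} {l : ℝ} (hl : 0 < l) (ha : Alt2 V x l) {h : E} (hh : h ≠ 0) :
    ∀ᶠ r : ℝ in 𝓝[>] 0, V ((1 / r) • h) * r ^ 2 = Phi V x l h r := by
  filter_upwards [ray_far x l hh] with r hr
  have h1 := ha _ hr.2
  have h2 := Phi_geom V x (l := l) h hr.1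
  rw [← h1] at h2
  unfold Phi
  rw [div_mul_eq_mul_div, eq_div_iff (by positivity), ← h2]
  ring

lemma ray_alt1 {V : E → ℝ} {x : E} {l : ℝ} (hl : 0 < l) (ha : Alt1 V x) {h : E} (hh : h ≠ 0) :
    ∀ᶠ r : ℝ in 𝓝[>] 0, V ((1 / r) • h) * r ^ 2 ≤ Phi V x l h r := by
  filter_upwards [ray_far x l hh] with r hr
  have h1 := ha l hl _ hr.2
  have h2 := Phi_geom V x (l := l) h hr.1
  have h3 := mul_le_mul_of_nonneg_right h1 (sq_nonneg r)
  rw [h2] at h3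
  unfold Phi
  rw [div_mul_eq_mul_div, le_div_iff₀ (by positivity)]
  linarith

lemma alt1_const {V : E → ℝ} (hV : ∀ x, 0 < V x) (ha : ∀ x, Alt1 V x) (z z' : E) : V z ≤ V z' := by
  by_cases hzz : z = z'
  · rw [hzz]
  have hd : 0 < ‖z - z'‖ := norm_pos_iff.2 (sub_ne_zero.2 hzz)
  have key : ∀ T : ℝ, 0 < T → V z ≤ (1 + T⁻¹) * V z' := by
    intro T hT
    set x := z' - T • (z - z') with hx
    have e1 : z - x = (1 + T) • (z - z') := by rw [hx]; module
    have hl2 : (Real.sqrt (T * (1 + T)) * ‖z - z'‖) ^ 2 = T * (1 + T) * ‖z - z'‖ ^ 2 := by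
      rw [mul_pow, Real.sq_sqrt (by positivity)]
    have h1 := ha x (Real.sqrt (T * (1 + T)) * ‖z - z'‖) (by positivity) z (by
      rw [e1, norm_smul, Real.norm_of_nonneg (by positivity)]
      gcongr
      rw [Real.sqrt_le_left (by positivity)]
      nlinarith)
    rw [hl2, e1, norm_smul, Real.norm_of_nonneg (by positivity), smul_smul] at h1
    have e2 : T * (1 + T) * ‖z - z'‖ ^ 2 / ((1 + T) * ‖z - z'‖) ^ 2 * (1 + T) = T := by
      field_simp
    have e3 : x + T • (z - z') = z' := by rw [hx]; module
    rw [e2, e3] at h1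
    have h2 : (V z * T) * ((1 + T) * ‖z - z'‖ ^ 2) ≤ ((1 + T) * V z') * ((1 + T) * ‖z - z'‖ ^ 2) := by
      linarith
    have h3 := le_of_mul_le_mul_right h2 (by positivity)
    have : (1 + T⁻¹) * V z' = ((1 + T) * V z') / T := by field_simp; ring
    rw [this, le_div_iff₀ hT]
    exact h3
  have ht : Tendsto (fun T : ℝ => (1 + T⁻¹) * V z') atTop (𝓝 ((1 + 0) * V z')) :=
    (tendsto_inv_atTop_zero.const_add 1).mul_const _
  have := ge_of_tendsto ht (by filter_upwards [eventually_gt_atTop 0] with T hT using key T hT)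
  simpa using this

lemma alt_mix {V : E → ℝ} (hd : Differentiable ℝ V) (hV : ∀ x, 0 < V x) {x y : E} {l : ℝ}
    (hl : 0 < l) (h2 : Alt2 V x l) (h1 : Alt1 V y) {h : E} (hh : h ≠ 0) : False := by
  have hn : 0 < ‖h‖ := norm_pos_iff.2 hh
  have key : ∀ μ > 0, ‖h‖ ^ 2 / l ^ 2 * V x ≤ ‖h‖ ^ 2 / μ ^ 2 * V y := by
    intro μ hμ
    rw [← Phi_zero, ← Phi_zero]
    have t1 := ((Phi_deriv hd x hl hh).continuousAt.tendsto).mono_left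
      (nhdsWithin_le_nhds (s := Set.Ioi 0))
    have t2 := ((Phi_deriv hd y hμ hh).continuousAt.tendsto).mono_left
      (nhdsWithin_le_nhds (s := Set.Ioi 0))
    refine le_of_tendsto_of_tendsto t1 t2 ?_
    filter_upwards [ray_alt2 hl h2 hh, ray_alt1 hμ h1 hh] with r h3 h4
    rw [← h3]; exact h4
  have hx := hV x
  have hy := hV y
  have hc : 0 < ‖h‖ ^ 2 / l ^ 2 * V x := by positivity
  have ht : Tendsto (fun μ : ℝ => ‖h‖ ^ 2 / μ ^ 2 * V y) atTop (𝓝 (0 * V y)) :=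
    (tendsto_const_nhds.div_atTop (tendsto_pow_atTop (by norm_num))).mul_const _
  have := ge_of_tendsto ht (by filter_upwards [eventually_gt_atTop 0] with T hT using key T hT)
  linarith

lemma alt2_two {V : E → ℝ} (hd : Differentiable ℝ V) {x y : E} {l μ : ℝ} (hl : 0 < l) (hμ : 0 < μ)
    (h1 : Alt2 V x l) (h2 : Alt2 V y μ) {h : E} (hh : h ≠ 0) :
    V x / l ^ 2 = V y / μ ^ 2 ∧
    fderiv ℝ V x h - 2 * (V x / l ^ 2) * inner ℝ x h =
      fderiv ℝ V y h - 2 * (V y / μ ^ 2) * inner ℝ y h := by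
  have hn : 0 < ‖h‖ := norm_pos_iff.2 hh
  have d1 := Phi_deriv hd x hl hh
  have d2 := Phi_deriv hd y hμ hh
  have he : Phi V x l h =ᶠ[𝓝[>] 0] Phi V y μ h := by
    filter_upwards [ray_alt2 hl h1 hh, ray_alt2 hμ h2 hh] with r h3 h4
    rw [← h3, h4]
  have h0 : Phi V x l h 0 = Phi V y μ h 0 :=
    tendsto_nhds_unique_of_eventuallyEq
      (d1.continuousAt.tendsto.mono_left (nhdsWithin_le_nhds (s := Set.Ioi 0)))
      (d2.continuousAt.tendsto.mono_left (nhdsWithin_le_nhds (s := Set.Ioi 0))) he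
  constructor
  · rw [Phi_zero, Phi_zero, div_mul_eq_mul_div, div_mul_eq_mul_div, mul_div_assoc, mul_div_assoc] at h0
    exact mul_left_cancel₀ (by positivity) h0
  · have d3 := (d2.hasDerivWithinAt (s := Set.Ioi 0)).congr_of_eventuallyEq he h0
    exact (uniqueDiffWithinAt_Ioi 0).eq_deriv _ d1.hasDerivWithinAt d3

lemma quad_of_alt2 {V : E → ℝ} (hd : Differentiable ℝ V) (hV : ∀ x, 0 < V x)
    (h : ∀ x, ∃ l > 0, Alt2 V x l) :
    ∃ A > 0, ∀ x, V x = V 0 + fderiv ℝ V 0 x + A * ‖x‖ ^ 2 := by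
  obtain ⟨l0, hl0, h0⟩ := h 0
  refine ⟨V 0 / l0 ^ 2, div_pos (hV 0) (by positivity), fun x => ?_⟩
  by_cases hx : x = 0
  · simp [hx]
  have hder : ∀ t : ℝ, fderiv ℝ V (t • x) x = fderiv ℝ V 0 x + 2 * (V 0 / l0 ^ 2) * (t * ‖x‖ ^ 2) := by
    intro t
    obtain ⟨l, hl, h1⟩ := h (t • x)
    obtain ⟨e1, e2⟩ := alt2_two hd hl hl0 h1 h0 hx
    rw [e1, inner_zero_left, inner_smul_left, real_inner_self_eq_norm_sq] at e2
    simp at e2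
    linarith
  have hg : ∀ t : ℝ, HasDerivAt (fun t : ℝ => V (t • x) - t * fderiv ℝ V 0 x -
      (V 0 / l0 ^ 2) * ‖x‖ ^ 2 * t ^ 2) 0 t := by
    intro t
    have a1 : HasDerivAt (fun t : ℝ => t • x) x t := by
      exact ((hasDerivAt_id t).smul_const x).congr_deriv (by simp)
    have a2 := (hd (t • x)).hasFDerivAt.comp_hasDerivAt t a1
    have a3 := (a2.sub ((hasDerivAt_id t).mul_const (fderiv ℝ V 0 x))).sub
      ((hasDerivAt_pow 2 t).const_mul ((V 0 / l0 ^ 2) * ‖x‖ ^ 2))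
    refine a3.congr_deriv ?_
    rw [hder t]
    simp
    ring
  have hc := is_const_of_deriv_eq_zero (fun t => (hg t).differentiableAt) (fun t => (hg t).deriv) 1 0
  simp at hc
  linarith

end absV
end LC


namespace LC
open Filter Topology
set_option linter.unusedSectionVars false
variable {ι : Type*} [DecidableEq ι] [Fintype ι]
variable {E0 : Type*} [NormedAddCommGroup E0] [InnerProductSpace ℝ E0]

lemma Sol.pos [Nonempty ι] {b : ι → ℝ} {σ : ℝ} {F : EuclideanSpace ℝ ι → ℝ} (h : Sol b σ F)
    {x : EuclideanSpace ℝ ι} (hx : x ∈ PP b) (h0 : 0 < F x) (z : EuclideanSpace ℝ ι) : 0 < F z := by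
  by_cases hz : z = x
  · rw [hz]; exact h0
  have hn : 0 < ‖z - x‖ := norm_pos_iff.2 (sub_ne_zero.2 hz)
  obtain ⟨ε, hε, hh⟩ := lower_bound (h.trans hx) (by simpa using h0) ‖z - x‖ hn
  have := hh (z - x) le_rfl
  simp only [add_sub_cancel] at this
  exact lt_of_lt_of_le (by positivity) this

lemma powid {σ ρ l k : ℝ} (hσ : 0 < σ) (hρ : 0 < ρ) (hl : 0 < l) (hk : 0 < k) :
    (ρ ^ (-σ) * (l ^ (2 * σ) * k)) ^ (-(1 / σ)) * l ^ 2 = ρ * k ^ (-(1 / σ)) := by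
  rw [Real.mul_rpow (by positivity) (by positivity), Real.mul_rpow (by positivity) (by positivity),
    ← Real.rpow_mul hρ.le, ← Real.rpow_mul hl.le]
  have e1 : -σ * -(1 / σ) = 1 := by field_simp
  have e2 : 2 * σ * -(1 / σ) = -2 := by field_simp
  rw [e1, e2, Real.rpow_one, Real.rpow_neg hl.le]
  norm_num
  field_simp

lemma classify [Nonempty ι] {b : ι → ℝ} {σ : ℝ} {F : EuclideanSpace ℝ ι → ℝ} (h : Sol b σ F)
    (J : E0 →ₗᵢ[ℝ] EuclideanSpace ℝ ι) (hJ : ∀ x, J x ∈ PP b) (hpos : ∀ z, 0 < F z)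
    {e : E0} (he : e ≠ 0) :
    (∀ x y, F (J x) = F (J y)) ∨
    ∃ (A c : ℝ) (ℓ : E0 →L[ℝ] ℝ), 0 < A ∧ ∀ x, 0 < c + ℓ x + A * ‖x‖ ^ 2 ∧
      F (J x) = (c + ℓ x + A * ‖x‖ ^ 2) ^ (-σ) := by
  have hσ := h.hσ
  set V : E0 → ℝ := fun x => F (J x) ^ (-(1 / σ)) with hVdef
  have hV : ∀ x, 0 < V x := fun x => Real.rpow_pos_of_pos (hpos _) _
  have hVF : ∀ x, F (J x) = V x ^ (-σ) := fun x => by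
    rw [hVdef]
    simp only
    rw [← Real.rpow_mul (hpos _).le]
    have : -(1 / σ) * -σ = 1 := by field_simp
    rw [this, Real.rpow_one]
  have hd : Differentiable ℝ V := by
    intro x
    have h1 : DifferentiableAt ℝ (fun x => F (J x)) x :=
      (h.diff (J x)).comp x J.toContinuousLinearMap.differentiableAt
    exact h1.rpow_const (Or.inl (hpos _).ne')
  have hfo : ∀ x z : E0, J x + J (z - x) = J z := fun x z => by rw [← map_add]; simp
  have hfo2 : ∀ (x z : E0) (c : ℝ), J x + c • J (z - x) = J (x + c • (z - x)) := fun x z c => by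
    rw [map_add, map_smul]
  have hdich : ∀ x, Alt1 V x ∨ ∃ l > 0, Alt2 V x l := by
    intro x
    rcases dich (h.trans (hJ x)) (by simpa using hpos (J x)) with h1 | ⟨l, hl, h2⟩
    · left
      intro l hl z hz
      have hz0 : 0 < ‖z - x‖ := hl.trans_le hz
      have h3 := h1 l hl (J (z - x)) (by rwa [J.norm_map])
      unfold Kel at h3
      beta_reduce at h3
      rw [J.norm_map, hfo, hfo2] at h3
      set z' := x + (l ^ 2 / ‖z - x‖ ^ 2) • (z - x)
      have hk := hpos (J z')
      have h4 := Real.rpow_le_rpow_of_nonpos (by positivity) h3 (show -(1 / σ) ≤ 0 by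
        have : 0 < 1 / σ := by positivity
        linarith)
      have h5 := powid hσ (show 0 < ‖z - x‖ ^ 2 by positivity) hl hk
      have h6 := mul_le_mul_of_nonneg_right h4 (sq_nonneg l)
      rw [h5] at h6
      exact h6
    · right
      refine ⟨l, hl, ?_⟩
      intro z hz
      have hz0 : 0 < ‖z - x‖ := hl.trans_le hz
      have h3 := h2 (J (z - x)) (hJ _) (by rwa [J.norm_map])
      unfold Kel at h3
      beta_reduce at h3
      rw [J.norm_map, hfo, hfo2] at h3
      set z' := x + (l ^ 2 / ‖z - x‖ ^ 2) • (z - x)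
      have h5 := powid hσ (show 0 < ‖z - x‖ ^ 2 by positivity) hl (hpos (J z'))
      rw [h3] at h5
      exact h5
  by_cases hall : ∀ x, ∃ l > 0, Alt2 V x l
  · right
    obtain ⟨A, hA, hq⟩ := quad_of_alt2 hd hV hall
    refine ⟨A, V 0, fderiv ℝ V 0, hA, fun x => ?_⟩
    rw [← hq x]
    exact ⟨hV x, hVF x⟩
  · left
    obtain ⟨y, hy⟩ := not_forall.1 hall
    have hy1 : Alt1 V y := (hdich y).resolve_right hy
    have hall1 : ∀ x, Alt1 V x := by
      intro x
      rcases hdich x with h1 | ⟨l, hl, h2⟩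
      · exact h1
      · exact (alt_mix hd hV hl h2 hy1 he).elim
    intro x y
    rw [hVF, hVF, le_antisymm (alt1_const hV hall1 x y) (alt1_const hV hall1 y x)]

end LC


namespace LC
open Filter Topology
set_option linter.unusedSectionVars false
variable {ι : Type*} [DecidableEq ι] [Fintype ι]

lemma bub_smooth {τ : ℝ} (hτ : 0 < τ) (x z : EuclideanSpace ℝ ι) (s : ℝ) :
    ContDiffAt ℝ 2 (fun z => (τ + ‖z - x‖ ^ 2) ^ s) z := by
  have h1 : ContDiffAt ℝ 2 (fun z => τ + ‖z - x‖ ^ 2) z :=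
    contDiffAt_const.add ((contDiffAt_id.sub contDiffAt_const).norm_sq ℝ)
  exact h1.rpow_const_of_ne (by positivity)

lemma bub_Lop {b : ι → ℝ} {τ : ℝ} (hτ : 0 < τ) {x z : EuclideanSpace ℝ ι} (hx : x ∈ PP b)
    (hQ : z ∈ QQ b) (s : ℝ) :
    Lop b (fun z => (τ + ‖z - x‖ ^ 2) ^ s) z =
      4 * s * (s - 1) * (τ + ‖z - x‖ ^ 2) ^ (s - 2) * ‖z - x‖ ^ 2 +
      2 * s * (τ + ‖z - x‖ ^ 2) ^ (s - 1) * (Fintype.card ι + ∑ j, b j) := by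
  have hρ : 0 < τ + ‖z - x‖ ^ 2 := by positivity
  set ρ := τ + ‖z - x‖ ^ 2 with hρd
  have hterm : ∀ j, fderiv ℝ (fderiv ℝ (fun z => (τ + ‖z - x‖ ^ 2) ^ s)) z (ee j) (ee j)
      + b j / z j * fderiv ℝ (fun z => (τ + ‖z - x‖ ^ 2) ^ s) z (ee j) =
      4 * s * (s - 1) * ρ ^ (s - 2) * ((z - x) j) ^ 2 + 2 * s * ρ ^ (s - 1)
        + 2 * s * ρ ^ (s - 1) * b j := by
    intro j
    obtain ⟨ha, hb⟩ := rad_line (ρ := ρ) (c := (z - x) j) (s := s) hρ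
    have hfun : (fun t : ℝ => (τ + ‖z + t • ee j - x‖ ^ 2) ^ s) =
        fun t : ℝ => (ρ + 2 * (z - x) j * t + t ^ 2) ^ s := by
      ext t
      have e : z + t • ee j - x = (z - x) + t • ee j := by abel
      rw [hρd, e, normsq_line]
      congr 1
      ring
    obtain ⟨h1, h2⟩ := line_lemma (e := ee j) (bub_smooth hτ x z s)
      (by rw [hfun]; exact ha.mono fun t ht => ht.2) hb
    rw [h1, h2]
    have : b j / z j * (z - x) j = b j := by
      by_cases hbj : b j = 0
      · simp [hbj]
      · simp only [PiLp.sub_apply, hx j hbj, sub_zero]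
        exact div_mul_cancel₀ _ (hQ j hbj)
    simp only [mul_zero, add_zero]
    have e0 : (0:ℝ)^2 = 0 := by norm_num
    rw [e0, add_zero]
    calc _ = s * ((s - 1) * ρ ^ (s - 2) * (2 * (z - x) j) ^ 2 + 2 * ρ ^ (s - 1)) +
          2 * s * ρ ^ (s - 1) * (b j / z j * (z - x) j) := by ring
      _ = _ := by rw [this]; ring
  unfold Lop
  rw [Finset.sum_congr rfl (fun j _ => hterm j), Finset.sum_add_distrib, Finset.sum_add_distrib,
    ← Finset.mul_sum, ← Finset.mul_sum, ← normsq]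
  simp only [Finset.sum_const, Finset.card_univ, nsmul_eq_mul, mul_add, Finset.mul_sum]
  ring

lemma bubble {b : ι → ℝ} {σ : ℝ} {F : EuclideanSpace ℝ ι → ℝ} (h : Sol b σ F)
    {x z : EuclideanSpace ℝ ι} (hx : x ∈ PP b) (hQ : z ∈ QQ b) {A τ : ℝ} (hA : 0 < A) (hτ : 0 < τ)
    (hF : ∀ z, F z = (A * (τ + ‖z - x‖ ^ 2)) ^ (-σ)) : 4 * σ * (σ + 1) * τ * A ^ 2 = 1 := by
  have hσ := h.hσ
  have hF2 : F = fun z => A ^ (-σ) * (τ + ‖z - x‖ ^ 2) ^ (-σ) + 0 * (τ + ‖z - x‖ ^ 2) ^ (-σ) + 0 := by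
    ext z
    rw [hF, Real.mul_rpow hA.le (by positivity)]; ring
  have h1 := h.eqn z hQ
  rw [hF z] at h1
  rw [hF2, Lop_lin (bub_smooth hτ x z _) (bub_smooth hτ x z _), bub_Lop hτ hx hQ, ← h.hN] at h1
  have hρ : 0 < τ + ‖z - x‖ ^ 2 := by positivity
  obtain ⟨ρ, hρd⟩ : ∃ ρ, ρ = τ + ‖z - x‖ ^ 2 := ⟨_, rfl⟩
  have e0 : ‖z - x‖ ^ 2 = ρ - τ := by rw [hρd]; ring
  rw [← hρd] at h1 hρ
  rw [e0] at h1
  rw [← Real.rpow_mul (by positivity), Real.mul_rpow hA.le hρ.le] at h1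
  have e1 : -σ * ((σ + 2) / σ) = -σ - 2 := by field_simp; ring
  have e2 : ρ ^ (-σ - 1) = ρ ^ (-σ - 2) * ρ := by
    rw [← Real.rpow_add_one hρ.ne']; congr 1; ring
  have e3 : A ^ (-σ) = A ^ (-σ - 2) * A ^ 2 := by
    rw [← Real.rpow_natCast, ← Real.rpow_add hA]; congr 1; norm_num
  rw [e1, e2, e3] at h1
  have p1 : 0 < ρ ^ (-σ - 2) := by positivity
  have p2 : 0 < A ^ (-σ - 2) := by positivity
  have h2 : (A ^ (-σ - 2) * ρ ^ (-σ - 2)) * (4 * σ * (σ + 1) * τ * A ^ 2) =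
      (A ^ (-σ - 2) * ρ ^ (-σ - 2)) * 1 := by linarith
  exact mul_left_cancel₀ (by positivity) h2

end LC


namespace LC
open Filter Topology

lemma deriv_shift {φ g : ℝ → ℝ} {c s : ℝ}
    (h1 : ∀ᶠ t in 𝓝 (0:ℝ), HasDerivAt (fun t => φ (c + t)) (g t) t) (h2 : HasDerivAt g s 0) :
    deriv φ c = g 0 ∧ deriv (fun t => deriv φ t) c = s := by
  have h3 : ∀ᶠ t in 𝓝 (0:ℝ), HasDerivAt φ (g t) (c + t) := by
    filter_upwards [h1] with t ht
    have := HasDerivAt.comp_sub_const (c + t) c (f := fun t => φ (c + t)) (f' := g t) (by simpa using ht)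
    simpa using this
  have h4 : ∀ᶠ r in 𝓝 c, deriv φ r = g (r - c) := by
    have ht : Tendsto (fun r : ℝ => r - c) (𝓝 c) (𝓝 0) := by
      have : Continuous (fun r : ℝ => r - c) := by fun_prop
      simpa using this.tendsto c
    filter_upwards [ht.eventually h3] with r hr
    simpa using hr.deriv
  refine ⟨by simpa using h3.self_of_nhds.deriv, ?_⟩
  rw [Filter.EventuallyEq.deriv_eq h4]
  exact (HasDerivAt.comp_sub_const c c (f := g) (by simpa using h2)).deriv

lemma quad_line {E E' : Type*} [NormedAddCommGroup E] [NormedSpace ℝ E] [NormedAddCommGroup E']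
    [NormedSpace ℝ E'] {f : E → ℝ} {u : E' → ℝ} {z e : E} {p e' : E'} {c : ℝ}
    (hf : ContDiffAt ℝ 2 f z) (hu : ContDiffAt ℝ 2 u p)
    (hfu : ∀ t : ℝ, f (z + t • e) = u (p + ((2 * c * t + t ^ 2) / 4) • e')) :
    fderiv ℝ f z e = fderiv ℝ u p e' * (c / 2) ∧
    fderiv ℝ (fderiv ℝ f) z e e =
      fderiv ℝ (fderiv ℝ u) p e' e' * (c / 2) ^ 2 + fderiv ℝ u p e' / 2 := by
  have hθ : ∀ t : ℝ, HasDerivAt (fun t : ℝ => (2 * c * t + t ^ 2) / 4) ((c + t) / 2) t := by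
    intro t
    have := (((hasDerivAt_id t).const_mul (2 * c)).add (hasDerivAt_pow 2 t)).div_const 4
    exact this.congr_deriv (by simp; ring)
  have ht : Tendsto (fun t : ℝ => (2 * c * t + t ^ 2) / 4) (𝓝 0) (𝓝 0) := by
    simpa using (hθ 0).continuousAt.tendsto
  have h2 := line_second e' hu
  have h := line_lemma (e := e) hf
    (g := fun t => fderiv ℝ u (p + ((2 * c * t + t ^ 2) / 4) • e') e' * ((c + t) / 2))
    (s := fderiv ℝ (fderiv ℝ u) p e' e' * (c / 2) ^ 2 + fderiv ℝ u p e' / 2) ?_ ?_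
  · simpa using h
  · filter_upwards [ht.eventually (line_eventually e' hu)] with t h1
    have := h1.comp t (hθ t)
    exact this.congr_of_eventuallyEq (Eventually.of_forall hfu)
  · have h3 : HasDerivAt (fun t : ℝ => fderiv ℝ u (p + t • e') e') (fderiv ℝ (fderiv ℝ u) p e' e')
      ((2 * c * 0 + 0 ^ 2) / 4) := by simpa using h2
    have h4 := h3.comp (0:ℝ) (hθ 0)
    have h5 : HasDerivAt (fun t : ℝ => (c + t) / 2) (1 / 2) 0 :=
      ((hasDerivAt_id (0:ℝ)).const_add c).div_const 2
    refine (h4.mul h5).congr_deriv ?_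
    simp
    ring

section
variable {n m : ℕ}

lemma pdxx_eq {u : (Fin n → ℝ) × (Fin m → ℝ) → ℝ} {x : Fin n → ℝ} {y : Fin m → ℝ}
    (hu : ContDiffAt ℝ 2 u (x, y)) (i : Fin n) :
    pdxx n m u i x y = fderiv ℝ (fderiv ℝ u) (x, y) (Pi.single i 1, 0) (Pi.single i 1, 0) := by
  have e : ∀ t : ℝ, u (Function.update x i (x i + t), y) = u ((x, y) + t • (Pi.single i 1, 0)) := by
    intro t
    congr 1
    ext j
    · by_cases hj : j = i
      · subst hj; simp
      · simp [hj]
    · simp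
  have := deriv_shift (φ := fun s => u (Function.update x i s, y)) (c := x i)
    (by
      filter_upwards [line_eventually ((Pi.single i 1, 0) : (Fin n → ℝ) × (Fin m → ℝ)) hu] with t ht
      exact ht.congr_of_eventuallyEq (Eventually.of_forall e)) (line_second _ hu)
  exact this.2

lemma pdy_eq {u : (Fin n → ℝ) × (Fin m → ℝ) → ℝ} {x : Fin n → ℝ} {y : Fin m → ℝ}
    (hu : ContDiffAt ℝ 2 u (x, y)) (i : Fin m) :
    pdy n m u i x y = fderiv ℝ u (x, y) (0, Pi.single i 1) ∧
    pdyy n m u i x y = fderiv ℝ (fderiv ℝ u) (x, y) (0, Pi.single i 1) (0, Pi.single i 1) := by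
  have e : ∀ t : ℝ, u (x, Function.update y i (y i + t)) = u ((x, y) + t • (0, Pi.single i 1)) := by
    intro t
    congr 1
    ext j
    · simp
    · by_cases hj : j = i
      · subst hj; simp
      · simp [hj]
  have := deriv_shift (φ := fun s => u (x, Function.update y i s)) (c := y i)
    (by
      filter_upwards [line_eventually ((0, Pi.single i 1) : (Fin n → ℝ) × (Fin m → ℝ)) hu] with t ht
      exact ht.congr_of_eventuallyEq (Eventually.of_forall e)) (line_second _ hu)
  refine ⟨this.1.trans (by simp), this.2⟩

lemma pdxx_pt {u : (Fin n → ℝ) × (Fin m → ℝ) → ℝ} {p : (Fin n → ℝ) × (Fin m → ℝ)}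
    (hu : ContDiffAt ℝ 2 u p) (i : Fin n) :
    pdxx n m u i p.1 p.2 = fderiv ℝ (fderiv ℝ u) p (Pi.single i 1, 0) (Pi.single i 1, 0) :=
  pdxx_eq (x := p.1) (y := p.2) hu i

lemma pdy_pt {u : (Fin n → ℝ) × (Fin m → ℝ) → ℝ} {p : (Fin n → ℝ) × (Fin m → ℝ)}
    (hu : ContDiffAt ℝ 2 u p) (i : Fin m) :
    pdy n m u i p.1 p.2 = fderiv ℝ u p (0, Pi.single i 1) ∧
    pdyy n m u i p.1 p.2 = fderiv ℝ (fderiv ℝ u) p (0, Pi.single i 1) (0, Pi.single i 1) :=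
  pdy_eq (x := p.1) (y := p.2) hu i

/-- The lifting map. -/
noncomputable def TT (n m : ℕ) (z : EuclideanSpace ℝ (Fin n ⊕ (Fin m ⊕ Fin m))) :
    (Fin n → ℝ) × (Fin m → ℝ) :=
  (fun i => z (Sum.inl i), fun i => (z (Sum.inr (Sum.inl i)) ^ 2 + z (Sum.inr (Sum.inr i)) ^ 2) / 4)

/-- The weights. -/
def bb (n : ℕ) {m : ℕ} (av : Fin m → ℝ) : Fin n ⊕ (Fin m ⊕ Fin m) → ℝ :=
  Sum.elim (fun _ => 0) (Sum.elim (fun _ => 0) (fun i => 2 * av i - 2))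

lemma TT_smooth (z : EuclideanSpace ℝ (Fin n ⊕ (Fin m ⊕ Fin m))) :
    ContDiffAt ℝ 2 (TT n m) z := by
  unfold TT
  refine ContDiffAt.prodMk (contDiffAt_pi.2 fun i => ?_) (contDiffAt_pi.2 fun i => ?_)
  · fun_prop
  · fun_prop

lemma TT_nonneg (z : EuclideanSpace ℝ (Fin n ⊕ (Fin m ⊕ Fin m))) : ∀ i, 0 ≤ (TT n m z).2 i := by
  intro i
  simp only [TT]
  positivity

lemma lift_Sol (av : Fin m → ℝ) (hav : ∀ i, 1 < av i) {a : ℝ} (hA : a = ∑ i, av i) {σ : ℝ}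
    (hσ : 0 < σ) (hσN : 2 * σ + 2 = n + 2 * a)
    (u : (Fin n → ℝ) × (Fin m → ℝ) → ℝ)
    (hreg : ContDiffOn ℝ 2 u {p : (Fin n → ℝ) × (Fin m → ℝ) | ∀ i, 0 ≤ p.2 i})
    (hnonneg : ∀ (x : Fin n → ℝ) (y : Fin m → ℝ), (∀ i, 0 ≤ y i) → 0 ≤ u (x, y))
    (heq : ∀ (x : Fin n → ℝ) (y : Fin m → ℝ), (∀ i, 0 < y i) →
      (∑ i, y i * pdyy n m u i x y) + (∑ i, av i * pdy n m u i x y) +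
        (∑ i, pdxx n m u i x y) + u (x, y) ^ ((σ + 2) / σ) = 0) :
    Sol (bb n av) σ (fun z => u (TT n m z)) := by
  have hpos : ∀ z ∈ QQ (bb n av), ∀ i, 0 < (TT n m z).2 i := by
    intro z hz i
    have := hz (Sum.inr (Sum.inr i)) (by simp [bb]; linarith [hav i])
    simp only [TT]
    positivity
  have huc : ∀ z ∈ QQ (bb n av), ContDiffAt ℝ 2 u (TT n m z) := by
    intro z hz
    apply hreg.contDiffAt
    have ho : IsOpen {p : (Fin n → ℝ) × (Fin m → ℝ) | ∀ i, 0 < p.2 i} := by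
      simp only [Set.setOf_forall]
      exact isOpen_iInter_of_finite fun i => isOpen_lt continuous_const (by fun_prop)
    exact mem_of_superset (ho.mem_nhds (hpos z hz)) (fun p hp i => (hp i).le)
  have hUc : ∀ z ∈ QQ (bb n av), ContDiffAt ℝ 2 (fun z => u (TT n m z)) z := fun z hz =>
    ContDiffAt.comp (f := TT n m) z (huc z hz) (TT_smooth z)
  refine ⟨hσ, ?_, ?_, ?_, hUc, fun z => hnonneg _ _ (TT_nonneg z), ?_⟩
  · rw [hσN, hA]
    simp [bb, Finset.sum_sub_distrib, ← Finset.mul_sum]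
    ring
  · rintro (i | i | i)
    · simp [bb]
    · simp [bb]
    · simp [bb]; linarith [hav i]
  · intro z
    have h1 : DifferentiableWithinAt ℝ u {p : (Fin n → ℝ) × (Fin m → ℝ) | ∀ i, 0 ≤ p.2 i} (TT n m z) :=
      hreg.differentiableOn (by norm_num) _ (TT_nonneg z)
    have h2 : DifferentiableWithinAt ℝ (TT n m) Set.univ z :=
      ((TT_smooth z).differentiableAt (by norm_num)).differentiableWithinAt
    have := h1.comp z h2 (fun z _ => TT_nonneg z)
    exact differentiableWithinAt_univ.1 this
  · intro z hz
    have hu := huc z hz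
    have hU := hUc z hz
    have hq := hpos z hz
    have hE := heq (TT n m z).1 (TT n m z).2 hq
    have hx : ∀ i : Fin n, fderiv ℝ (fderiv ℝ (fun z => u (TT n m z))) z (ee (Sum.inl i)) (ee (Sum.inl i))
        = pdxx n m u i (TT n m z).1 (TT n m z).2 := by
      intro i
      rw [pdxx_pt hu]
      refine (line_lemma hU (g := fun t => fderiv ℝ u (TT n m z + t • (Pi.single i 1, 0)) (Pi.single i 1, 0))
        ?_ (line_second _ hu)).2
      filter_upwards [line_eventually ((Pi.single i 1, 0) : (Fin n → ℝ) × (Fin m → ℝ)) hu] with t ht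
      refine ht.congr_of_eventuallyEq (Eventually.of_forall fun t => ?_)
      simp only
      congr 1
      ext j
      · by_cases hj : j = i
        · subst hj; simp [TT, ee_apply]
        · simp [TT, ee_apply, hj]
      · simp [TT, ee_apply]
    have hp : ∀ i : Fin m, fderiv ℝ (fderiv ℝ (fun z => u (TT n m z))) z (ee (Sum.inr (Sum.inl i)))
        (ee (Sum.inr (Sum.inl i))) = pdyy n m u i (TT n m z).1 (TT n m z).2 * (z (Sum.inr (Sum.inl i)) / 2) ^ 2
          + pdy n m u i (TT n m z).1 (TT n m z).2 / 2 := by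
      intro i
      rw [(pdy_pt hu i).1, (pdy_pt hu i).2]
      refine (quad_line hU hu fun t => ?_).2
      congr 1
      ext j
      · simp [TT, ee_apply]
      · by_cases hj : j = i
        · subst hj; simp [TT, ee_apply]; ring
        · simp [TT, ee_apply, hj]
    have hqq : ∀ i : Fin m, fderiv ℝ (fun z => u (TT n m z)) z (ee (Sum.inr (Sum.inr i)))
        = pdy n m u i (TT n m z).1 (TT n m z).2 * (z (Sum.inr (Sum.inr i)) / 2) ∧
        fderiv ℝ (fderiv ℝ (fun z => u (TT n m z))) z (ee (Sum.inr (Sum.inr i)))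
        (ee (Sum.inr (Sum.inr i))) = pdyy n m u i (TT n m z).1 (TT n m z).2 * (z (Sum.inr (Sum.inr i)) / 2) ^ 2
          + pdy n m u i (TT n m z).1 (TT n m z).2 / 2 := by
      intro i
      rw [(pdy_pt hu i).1, (pdy_pt hu i).2]
      refine quad_line hU hu fun t => ?_
      congr 1
      ext j
      · simp [TT, ee_apply]
      · by_cases hj : j = i
        · subst hj; simp [TT, ee_apply]; ring
        · simp [TT, ee_apply, hj]
    unfold Lop
    rw [Fintype.sum_sum_type, Fintype.sum_sum_type]
    simp only [hx, hp, (hqq _).1, (hqq _).2]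
    have e1 : ∑ i : Fin m, (pdyy n m u i (TT n m z).1 (TT n m z).2 * (z (Sum.inr (Sum.inl i)) / 2) ^ 2
          + pdy n m u i (TT n m z).1 (TT n m z).2 / 2) +
        ∑ i : Fin m, (pdyy n m u i (TT n m z).1 (TT n m z).2 * (z (Sum.inr (Sum.inr i)) / 2) ^ 2
          + pdy n m u i (TT n m z).1 (TT n m z).2 / 2 + (2 * av i - 2) / z (Sum.inr (Sum.inr i)) *
          (pdy n m u i (TT n m z).1 (TT n m z).2 * (z (Sum.inr (Sum.inr i)) / 2))) =
        ∑ i, (TT n m z).2 i * pdyy n m u i (TT n m z).1 (TT n m z).2 +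
        ∑ i, av i * pdy n m u i (TT n m z).1 (TT n m z).2 := by
      rw [← Finset.sum_add_distrib, ← Finset.sum_add_distrib]
      refine Finset.sum_congr rfl fun i _ => ?_
      have hne := hz (Sum.inr (Sum.inr i)) (by simp [bb]; linarith [hav i])
      have e2 : (TT n m z).2 i = (z (Sum.inr (Sum.inl i)) ^ 2 + z (Sum.inr (Sum.inr i)) ^ 2) / 4 := rfl
      rw [e2]
      field_simp
      ring
    simp only [bb, Sum.elim_inl, Sum.elim_inr, zero_div, zero_mul, add_zero]
    rw [e1]
    have : u (TT n m z) = u ((TT n m z).1, (TT n m z).2) := rfl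
    linarith

end
end LC


namespace LC
open Filter Topology
section
variable {n m : ℕ}

/-- Embedding of the center plane. -/
noncomputable def JJ (n m : ℕ) :
    EuclideanSpace ℝ (Fin n ⊕ Fin m) →ₗᵢ[ℝ] EuclideanSpace ℝ (Fin n ⊕ (Fin m ⊕ Fin m)) where
  toFun x := WithLp.toLp 2 (Sum.elim (fun i => x (Sum.inl i)) (Sum.elim (fun i => x (Sum.inr i)) 0))
  map_add' x y := by
    ext (j | j | j) <;> simp
  map_smul' c x := by
    ext (j | j | j) <;> simp
  norm_map' x := by
    simp [EuclideanSpace.norm_eq]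

lemma JJ_inl (x : EuclideanSpace ℝ (Fin n ⊕ Fin m)) (i : Fin n) : JJ n m x (Sum.inl i) = x (Sum.inl i) := rfl
lemma JJ_inrl (x : EuclideanSpace ℝ (Fin n ⊕ Fin m)) (i : Fin m) :
    JJ n m x (Sum.inr (Sum.inl i)) = x (Sum.inr i) := rfl
lemma JJ_inrr (x : EuclideanSpace ℝ (Fin n ⊕ Fin m)) (i : Fin m) :
    JJ n m x (Sum.inr (Sum.inr i)) = 0 := rfl

/-- Point of the center plane. -/
noncomputable def pt (x : Fin n → ℝ) (p : Fin m → ℝ) : EuclideanSpace ℝ (Fin n ⊕ Fin m) :=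
  WithLp.toLp 2 (Sum.elim x p)

lemma pt_inl (x : Fin n → ℝ) (p : Fin m → ℝ) (i : Fin n) : pt x p (Sum.inl i) = x i := rfl
lemma pt_inr (x : Fin n → ℝ) (p : Fin m → ℝ) (i : Fin m) : pt x p (Sum.inr i) = p i := rfl

lemma JJ_PP (av : Fin m → ℝ) (x : EuclideanSpace ℝ (Fin n ⊕ Fin m)) : JJ n m x ∈ PP (bb n av) := by
  rintro (i | i | i) hi
  · simp [bb] at hi
  · simp [bb] at hi
  · rfl

lemma TT_JJ (x : Fin n → ℝ) (p : Fin m → ℝ) :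
    TT n m (JJ n m (pt x p)) = (x, fun i => p i ^ 2 / 4) := by
  unfold TT
  simp only [JJ_inl, JJ_inrl, JJ_inrr, pt_inl, pt_inr]
  congr 1
  ext i
  ring

lemma TT_sqrt (x : Fin n → ℝ) (y : Fin m → ℝ) (hy : ∀ i, 0 ≤ y i) :
    TT n m (JJ n m (pt x (fun i => 2 * Real.sqrt (y i)))) = (x, y) := by
  rw [TT_JJ]
  congr 1
  ext i
  rw [mul_pow, Real.sq_sqrt (hy i)]
  ring

end
end LC

open LC

/-- Theorem 3.1(2): classification of nonnegative solutions of the equation with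
several degenerate directions in the critical case `α = (n+2a+2)/(n+2a-2)`. -/
theorem liouville_critical_multi (n m : ℕ) (hn : 1 ≤ n) (hm : 1 ≤ m)
    (av : Fin m → ℝ) (hav : ∀ i, 1 < av i) (a : ℝ) (hA : a = ∑ i, av i)
    (α : ℝ) (hα : α = (n + 2 * a + 2) / (n + 2 * a - 2))
    (u : (Fin n → ℝ) × (Fin m → ℝ) → ℝ)
    (hreg : ContDiffOn ℝ 2 u {p : (Fin n → ℝ) × (Fin m → ℝ) | ∀ i, 0 ≤ p.2 i})
    (hnonneg : ∀ (x : Fin n → ℝ) (y : Fin m → ℝ), (∀ i, 0 ≤ y i) → 0 ≤ u (x, y))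
    (heq : ∀ (x : Fin n → ℝ) (y : Fin m → ℝ), (∀ i, 0 < y i) →
      (∑ i, y i * pdyy n m u i x y) + (∑ i, av i * pdy n m u i x y) +
        (∑ i, pdxx n m u i x y) + u (x, y) ^ α = 0) :
    ∃ (x₀ : Fin n → ℝ) (t : ℝ), 0 ≤ t ∧ ∀ (x : Fin n → ℝ) (y : Fin m → ℝ), (∀ i, 0 ≤ y i) →
      u (x, y) = (t * Real.sqrt ((n + 2 * a) * (n + 2 * a - 2)) /
        (t ^ 2 + 4 * ∑ i, y i + ∑ i, (x i - x₀ i) ^ 2)) ^ ((n + 2 * a - 2) / 2) := by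
  have ha1 : 1 < a := by
    have h0 : 1 < av ⟨0, hm⟩ := hav _
    rw [hA]
    refine lt_of_lt_of_le h0 (Finset.single_le_sum (f := av) (fun i _ => ?_) (Finset.mem_univ _))
    linarith [hav i]
  have hn1 : (1:ℝ) ≤ n := by exact_mod_cast hn
  obtain ⟨σ, hσd⟩ : ∃ σ, σ = (n + 2 * a - 2) / 2 := ⟨_, rfl⟩
  have hσ : 0 < σ := by rw [hσd]; linarith
  have hσN : 2 * σ + 2 = n + 2 * a := by rw [hσd]; ring
  have hασ : α = (σ + 2) / σ := by
    rw [hα, ← hσN, add_sub_cancel_right, div_eq_div_iff (by positivity) hσ.ne']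
    ring
  rw [hασ] at heq
  have hS := lift_Sol av hav hA hσ hσN u hreg hnonneg heq
  have hne : Nonempty (Fin n ⊕ (Fin m ⊕ Fin m)) := ⟨Sum.inl ⟨0, hn⟩⟩
  rw [← hσd, ← hσN]
  obtain ⟨z1, hz1⟩ : ∃ z : EuclideanSpace ℝ (Fin n ⊕ (Fin m ⊕ Fin m)), z ∈ QQ (bb n av) :=
    ⟨WithLp.toLp 2 (fun _ => 1), fun j _ => by simp⟩
  by_cases hz : ∀ x : EuclideanSpace ℝ (Fin n ⊕ Fin m), u (TT n m (JJ n m x)) = 0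
  · refine ⟨0, 0, le_rfl, fun x y hy => ?_⟩
    have := hz (pt x (fun i => 2 * Real.sqrt (y i)))
    rw [TT_sqrt x y hy] at this
    rw [this, zero_mul, zero_div, Real.zero_rpow hσ.ne']
  push Not at hz
  obtain ⟨ξ1, hξ1⟩ := hz
  have hpos : ∀ z, 0 < u (TT n m z) := hS.pos (JJ_PP av ξ1)
    (lt_of_le_of_ne (hS.nonneg _) (Ne.symm hξ1))
  have he : (pt (fun _ => 1) 0 : EuclideanSpace ℝ (Fin n ⊕ Fin m)) ≠ 0 := by
    intro h
    have := congrArg (fun v : EuclideanSpace ℝ (Fin n ⊕ Fin m) => v (Sum.inl ⟨0, hn⟩)) h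
    simp [pt_inl] at this
  have hlift : ∀ z : EuclideanSpace ℝ (Fin n ⊕ (Fin m ⊕ Fin m)),
      TT n m z = TT n m (JJ n m (pt (TT n m z).1 (fun i => 2 * Real.sqrt ((TT n m z).2 i)))) :=
    fun z => (TT_sqrt _ _ (TT_nonneg z)).symm
  rcases classify hS (JJ n m) (JJ_PP av) hpos he with hc | ⟨A, c, ℓ, hA0, hq⟩
  · exfalso
    have hconst : (fun z => u (TT n m z)) = fun _ => u (TT n m z1) := by
      ext z
      rw [hlift z, hlift z1]
      exact hc _ _
    have h1 := hS.eqn z1 hz1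
    rw [hconst] at h1
    have h2 := Real.rpow_pos_of_pos (hpos z1) ((σ + 2) / σ)
    simp [Lop] at h1
    linarith
  · obtain ⟨w, hw⟩ : ∃ w : EuclideanSpace ℝ (Fin n ⊕ Fin m), ∀ ξ, ℓ ξ = inner ℝ w ξ :=
      ⟨(InnerProductSpace.toDual ℝ _).symm ℓ, fun ξ => by simp⟩
    have hw0 : ∀ i : Fin m, w (Sum.inr i) = 0 := by
      intro i
      have hℓ : ℓ (EuclideanSpace.single (Sum.inr i) 1) = w (Sum.inr i) := by
        rw [hw, EuclideanSpace.inner_single_right]; simp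
      obtain ⟨p1, e1⟩ := hq (EuclideanSpace.single (Sum.inr i) 1)
      obtain ⟨p2, e2⟩ := hq (-(EuclideanSpace.single (Sum.inr i) 1))
      have e3 : TT n m (JJ n m (-(EuclideanSpace.single (Sum.inr i) 1))) =
          TT n m (JJ n m (EuclideanSpace.single (Sum.inr i) 1)) := by
        simp [TT, JJ_inl, JJ_inrl, JJ_inrr]
      rw [e3, e1] at e2
      have e4 := (Real.rpow_left_inj p1.le p2.le (by linarith : -σ ≠ 0)).1 e2
      rw [map_neg, norm_neg, hℓ] at e4
      linarith
    set ξ0 : EuclideanSpace ℝ (Fin n ⊕ Fin m) := (-(1 / (2 * A))) • w with hξ0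
    set τ := c / A - ‖ξ0‖ ^ 2 with hτ
    have hquad : ∀ ξ, c + ℓ ξ + A * ‖ξ‖ ^ 2 = A * (τ + ‖ξ - ξ0‖ ^ 2) := by
      intro ξ
      rw [@norm_sub_sq_real, hτ, hξ0, inner_smul_right, hw, real_inner_comm]
      field_simp
      ring
    have hτ0 : 0 < τ := by
      have := (hq ξ0).1
      rw [hquad] at this
      simp at this
      exact (pos_iff_pos_of_mul_pos this).1 hA0
    have hF : ∀ ξ, u (TT n m (JJ n m ξ)) = (A * (τ + ‖ξ - ξ0‖ ^ 2)) ^ (-σ) := fun ξ => by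
      rw [← hquad]; exact (hq ξ).2
    have hξ0r : ∀ i : Fin m, ξ0 (Sum.inr i) = 0 := fun i => by simp [hξ0, hw0]
    have hnorm : ∀ (x : Fin n → ℝ) (y : Fin m → ℝ), (∀ i, 0 ≤ y i) →
        ‖pt x (fun i => 2 * Real.sqrt (y i)) - ξ0‖ ^ 2 =
          4 * ∑ i, y i + ∑ i, (x i - ξ0 (Sum.inl i)) ^ 2 := by
      intro x y hy
      rw [normsq, Fintype.sum_sum_type, add_comm, Finset.mul_sum]
      congr 1
      refine Finset.sum_congr rfl fun i _ => ?_
      rw [PiLp.sub_apply, pt_inr, hξ0r, sub_zero, mul_pow, Real.sq_sqrt (hy i)]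
      norm_num
    have hFz : ∀ z, u (TT n m z) = (A * (τ + ‖z - JJ n m ξ0‖ ^ 2)) ^ (-σ) := by
      intro z
      rw [hlift z, hF, hnorm _ _ (TT_nonneg z)]
      congr 3
      rw [normsq, Fintype.sum_sum_type, Fintype.sum_sum_type, ← Finset.sum_add_distrib, add_comm,
        Finset.mul_sum]
      congr 1
      refine Finset.sum_congr rfl fun i _ => ?_
      simp only [PiLp.sub_apply, JJ_inrl, JJ_inrr, hξ0r, TT]
      ring
    have hb := bubble hS (JJ_PP av ξ0) hz1 hA0 hτ0 hFz
    refine ⟨fun i => ξ0 (Sum.inl i), Real.sqrt τ, Real.sqrt_nonneg _, fun x y hy => ?_⟩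
    have h1 := hF (pt x (fun i => 2 * Real.sqrt (y i)))
    rw [TT_sqrt x y hy, hnorm x y hy] at h1
    rw [h1, Real.sq_sqrt hτ0.le, ← add_assoc]
    have hD : 0 < τ + 4 * ∑ i, y i + ∑ i, (x i - ξ0 (Sum.inl i)) ^ 2 := by
      have : 0 ≤ ∑ i, y i := Finset.sum_nonneg fun i _ => hy i
      positivity
    set D := τ + 4 * ∑ i, y i + ∑ i, (x i - ξ0 (Sum.inl i)) ^ 2
    have hone : Real.sqrt τ * Real.sqrt ((2 * σ + 2) * (2 * σ + 2 - 2)) = A⁻¹ := by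
      rw [← Real.sqrt_mul hτ0.le]
      have : τ * ((2 * σ + 2) * (2 * σ + 2 - 2)) = A⁻¹ ^ 2 := by
        field_simp
        linarith
      rw [this, Real.sqrt_sq (by positivity)]
    rw [hone, Real.rpow_neg (by positivity), ← Real.inv_rpow (by positivity)]
    congr 1
    field_simp
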